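/- arXiv:1205.3826 — 4 statements merged into one kernel-verified Lean document; each statement's English description precedes it below -/
import Mathlib

section
/- Let N ≥ 2 and let Γ : ℝ → ℝ be 2π-periodic, twice differentiable on (0, 2π), with Γ′(θ) < 0 for every θ ∈ (0, 2π), and with second derivative of constant sign on (0, 2π) (either Γ″(θ) ≥ 0 for every θ ∈ (0, 2π) or Γ″(θ) ≤ 0 for every θ ∈ (0, 2π)). Let I ⊆ ℝ be an interval and let Θ, Ψ : I → ℝ^{N−1} be solutions of the phase-difference dynamics on I such that Θ(t) ∈ C, Ψ(t) ∈ C and Θ(t) ≠ Ψ(t) for every t ∈ I. Then the function t ↦ ‖Θ(t) − Ψ(t)‖_{(1)} is strictly decreasing on I, i.e. for all t₁, t₂ ∈ I with t₁ < t₂ one has ‖Θ(t₂) − Ψ(t₂)‖_{(1)} < ‖Θ(t₁) − Ψ(t₁)‖_{(1)}. -/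
open Real Filter Set Topology

noncomputable section

/-- Right-hand side of the phase-difference dynamics on `ℝ^{N-1}` (components `1,…,N-1`). -/
def fullRHS (N : ℕ) (Γ : ℝ → ℝ) (x : ℕ → ℝ) (k : ℕ) : ℝ :=
  Γ (x k) + ∑ j ∈ (Finset.Icc 1 (N - 1)).erase k, Γ (x k - x j)
    - ∑ j ∈ Finset.Icc 1 (N - 1), Γ (-(x j))

/-- `Θ` is a solution of the phase-difference dynamics on `I`. -/
def IsSolFull (N : ℕ) (Γ : ℝ → ℝ) (I : Set ℝ) (Θ : ℝ → ℕ → ℝ) : Prop :=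
  ∀ k ∈ Finset.Icc 1 (N - 1), ∀ t ∈ I,
    HasDerivAt (fun s => Θ s k) (fullRHS N Γ (Θ t) k) t

/-- The open cone `C = {0 < x₁ < x₂ < … < x_{N-1} < 2π}`. -/
def inCone (N : ℕ) (x : ℕ → ℝ) : Prop :=
  0 < x 1 ∧ (∀ k ∈ Finset.Icc 1 (N - 2), x k < x (k + 1)) ∧ x (N - 1) < 2 * π

/-- The 1-norm (total variation) distance between the vectors with components `a,…,b` of `x,y`:
`|x_a - y_a| + Σ_{j=a}^{b-1} |(x_{j+1}-y_{j+1}) - (x_j-y_j)| + |x_b - y_b|`. -/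
def dist1 (a b : ℕ) (x y : ℕ → ℝ) : ℝ :=
  |x a - y a| + ∑ j ∈ Finset.Icc a (b - 1), |x (j + 1) - y (j + 1) - (x j - y j)|
    + |x b - y b|

/-- The lift to `ℕ` of `N` phases on the circle: the reference phase `0`, then `x 1, …, x (N - 1)`,
continued by adding `2π` after each turn. -/
def circleLift (N : ℕ) (x : ℕ → ℝ) (k : ℕ) : ℝ :=
  (if k % N = 0 then 0 else x (k % N)) + 2 * π * (k / N : ℕ)

/-- Velocity of the `k`-th oscillator, up to the self-coupling constant `Γ 0`. -/
def liftVelocity (N : ℕ) (Γ : ℝ → ℝ) (x : ℕ → ℝ) (k : ℕ) : ℝ :=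
  ∑ j ∈ Finset.range N, Γ (circleLift N x k - circleLift N x j)

theorem circleLift_zero (N : ℕ) (x : ℕ → ℝ) : circleLift N x 0 = 0 := by
  simp [circleLift]

theorem circleLift_add {N : ℕ} (hN : 0 < N) (x : ℕ → ℝ) (k : ℕ) :
    circleLift N x (k + N) = circleLift N x k + 2 * π := by
  simp only [circleLift, Nat.add_mod_right, Nat.add_div_right k hN]
  push_cast
  ring

theorem circleLift_self {N : ℕ} (hN : 0 < N) (x : ℕ → ℝ) : circleLift N x N = 2 * π := by
  simpa [circleLift_zero] using circleLift_add hN x 0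

theorem circleLift_of_mem {N k : ℕ} (hk : k ∈ Finset.Icc 1 (N - 1)) (x : ℕ → ℝ) :
    circleLift N x k = x k := by
  rw [Finset.mem_Icc] at hk
  have hkN : k < N := by omega
  simp [circleLift, Nat.mod_eq_of_lt hkN, Nat.div_eq_of_lt hkN, show k ≠ 0 by omega]

theorem circleLift_lt_succ {N : ℕ} (hN : 2 ≤ N) {x : ℕ → ℝ} (hx : inCone N x) (k : ℕ) :
    circleLift N x k < circleLift N x (k + 1) := by
  obtain ⟨h0, h1, h2⟩ := hx
  induction k using Nat.strong_induction_on with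
  | _ k ih =>
    rcases lt_or_ge k N with hk | hk
    · rcases Nat.eq_zero_or_pos k with rfl | hpos
      · rw [circleLift_zero, circleLift_of_mem (Finset.mem_Icc.2 (by omega))]
        exact h0
      · rw [circleLift_of_mem (Finset.mem_Icc.2 (by omega))]
        rcases Nat.lt_or_ge (k + 1) N with hk' | hk'
        · rw [circleLift_of_mem (Finset.mem_Icc.2 (by omega))]
          exact h1 k (Finset.mem_Icc.2 (by omega))
        · rw [show k + 1 = N by omega, circleLift_self (by omega), show k = N - 1 by omega]
          exact h2
    · obtain ⟨l, rfl⟩ := Nat.exists_eq_add_of_le' hk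
      rw [show l + N + 1 = l + 1 + N by ring, circleLift_add (by omega), circleLift_add (by omega)]
      linarith [ih l (by omega)]

theorem circleLift_strictMono {N : ℕ} (hN : 2 ≤ N) {x : ℕ → ℝ} (hx : inCone N x) :
    StrictMono (circleLift N x) :=
  strictMono_nat_of_lt_succ (circleLift_lt_succ hN hx)

theorem circleLift_sub_mem_Ioo {N : ℕ} (hN : 2 ≤ N) {x : ℕ → ℝ} (hx : inCone N x) (j : ℕ) {m : ℕ}
    (hm : 0 < m) (hmN : m < N) :
    circleLift N x (j + m) - circleLift N x j ∈ Ioo 0 (2 * π) := by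
  have h := circleLift_strictMono hN hx
  have h1 : circleLift N x j < circleLift N x (j + m) := h (by omega)
  have h2 : circleLift N x (j + m) < circleLift N x (j + N) := h (by omega)
  rw [circleLift_add (by omega)] at h2
  constructor <;> linarith

theorem fullRHS_eq_liftVelocity_sub {N k : ℕ} (hk : k ∈ Finset.Icc 1 (N - 1)) (Γ : ℝ → ℝ)
    (x : ℕ → ℝ) : fullRHS N Γ x k = liftVelocity N Γ x k - liftVelocity N Γ x 0 := by
  have hN : Finset.range N = insert 0 (Finset.Icc 1 (N - 1)) := by
    ext i
    simp only [Finset.mem_range, Finset.mem_insert, Finset.mem_Icc] at hk ⊢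
    omega
  have hsum (a : ℝ) : ∑ j ∈ Finset.Icc 1 (N - 1), Γ (a - circleLift N x j)
      = ∑ j ∈ Finset.Icc 1 (N - 1), Γ (a - x j) :=
    Finset.sum_congr rfl fun j hj => by rw [circleLift_of_mem hj]
  rw [fullRHS, liftVelocity, liftVelocity, hN, Finset.sum_insert (by simp),
    Finset.sum_insert (by simp), hsum, hsum, circleLift_zero, circleLift_of_mem hk,
    ← Finset.add_sum_erase _ (fun j => Γ (x k - x j)) hk]
  simp only [sub_zero, sub_self, zero_sub]
  ring

theorem hasDerivAt_circleLift {N : ℕ} (hN : 2 ≤ N) {Γ : ℝ → ℝ}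
    (hper : ∀ θ : ℝ, Γ (θ + 2 * π) = Γ θ) {I : Set ℝ} {Θ : ℝ → ℕ → ℝ} (hΘ : IsSolFull N Γ I Θ)
    {t : ℝ} (ht : t ∈ I) {k : ℕ} (hk : k ≤ N) :
    HasDerivAt (fun s => circleLift N (Θ s) k)
      (liftVelocity N Γ (Θ t) k - liftVelocity N Γ (Θ t) 0) t := by
  by_cases hk' : k ∈ Finset.Icc 1 (N - 1)
  · simp only [circleLift_of_mem hk']
    rw [← fullRHS_eq_liftVelocity_sub hk']
    exact hΘ k hk' t ht
  · rw [Finset.mem_Icc] at hk'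
    obtain rfl | rfl : k = 0 ∨ k = N := by omega
    · simp only [circleLift_zero, sub_self]
      exact hasDerivAt_const _ _
    · have hv : liftVelocity k Γ (Θ t) k = liftVelocity k Γ (Θ t) 0 := by
        refine Finset.sum_congr rfl fun j _ => ?_
        rw [circleLift_self (by omega), circleLift_zero, ← hper (0 - _)]
        ring_nf
      simp only [circleLift_self (show 0 < k by omega), hv, sub_self]
      exact hasDerivAt_const _ _

theorem dist1_eq_sum_circleLift {N : ℕ} (hN : 2 ≤ N) (x y : ℕ → ℝ) :
    dist1 1 (N - 1) x y = ∑ k ∈ Finset.range N,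
      |circleLift N x (k + 1) - circleLift N y (k + 1) - (circleLift N x k - circleLift N y k)| := by
  obtain ⟨n, rfl⟩ := Nat.exists_eq_add_of_le' hN
  have hmem {k : ℕ} (h1 : 1 ≤ k) (h2 : k ≤ n + 1) : k ∈ Finset.Icc 1 (n + 2 - 1) :=
    Finset.mem_Icc.2 (by omega)
  rw [Finset.sum_range_succ, Finset.sum_range_succ', circleLift_self (by omega),
    circleLift_self (by omega), circleLift_zero, circleLift_zero,
    circleLift_of_mem (hmem (by omega) (by omega)), circleLift_of_mem (hmem (by omega) (by omega)),
    circleLift_of_mem (hmem (by omega) (by omega)), circleLift_of_mem (hmem (by omega) (by omega)),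
    dist1, Finset.range_eq_Ico, Finset.sum_Ico_add' (fun i => |circleLift (n + 2) x (i + 1) -
      circleLift (n + 2) y (i + 1) - (circleLift (n + 2) x i - circleLift (n + 2) y i)|) 0 n 1]
  have hI : Finset.Icc 1 (n + 2 - 1 - 1) = Finset.Ico (0 + 1) (n + 1) := by
    ext i
    simp only [Finset.mem_Icc, Finset.mem_Ico]
    omega
  have hs : ∑ i ∈ Finset.Ico (0 + 1) (n + 1), |x (i + 1) - y (i + 1) - (x i - y i)| =
      ∑ i ∈ Finset.Ico (0 + 1) (n + 1), |circleLift (n + 2) x (i + 1) -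
        circleLift (n + 2) y (i + 1) - (circleLift (n + 2) x i - circleLift (n + 2) y i)| := by
    refine Finset.sum_congr rfl fun i hi => ?_
    rw [Finset.mem_Ico] at hi
    rw [circleLift_of_mem (hmem (by omega) (by omega)),
      circleLift_of_mem (hmem (by omega) (by omega)),
      circleLift_of_mem (hmem (by omega) (by omega)),
      circleLift_of_mem (hmem (by omega) (by omega))]
  have hlast : |x (n + 1) - y (n + 1)| = |2 * π - 2 * π - (x (n + 1) - y (n + 1))| := by
    rw [sub_self, zero_sub, abs_neg]
  rw [hI, hs, ← hlast]
  simp only [sub_self, sub_zero, zero_add, show n + 2 - 1 = n + 1 by omega]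
  ring

theorem abs_sub_le_sum_abs_succ_sub (E : ℕ → ℝ) {a b : ℕ} (h : a ≤ b) :
    |E b - E a| ≤ ∑ i ∈ Finset.Ico a b, |E (i + 1) - E i| := by
  rw [← Finset.sum_Ico_sub E h]
  exact Finset.abs_sum_le_sum_abs _ _

theorem sum_sign_mul_weighted_pos_of_antitone {N : ℕ} {E b σ : ℕ → ℝ} (hE0 : E 0 = 0)
    (hσ : ∀ m < N, |σ m| ≤ 1) (hδ : ∀ m < N, σ m * (E (m + 1) - E m) = |E (m + 1) - E m|)
    (hb : ∀ m < N, b (m + 1) ≤ b m) (hbN : 0 < b N)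
    (hpos : 0 < ∑ m ∈ Finset.range N, |E (m + 1) - E m|) :
    0 < ∑ m ∈ Finset.range N, σ m * (b (m + 1) * E (m + 1) - b m * E m) := by
  set P : ℕ → ℝ := fun m => ∑ i ∈ Finset.range m, |E (i + 1) - E i|
  have hP (m : ℕ) : |E m| ≤ P m := by
    simpa [hE0, P] using abs_sub_le_sum_abs_succ_sub E (Nat.zero_le m)
  calc 0 < b N * P N - b 0 * P 0 := by simpa [P] using mul_pos hbN hpos
    _ = ∑ m ∈ Finset.range N, (b (m + 1) * P (m + 1) - b m * P m) :=
      (Finset.sum_range_sub (fun m => b m * P m) N).symm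
    _ ≤ _ := by
      refine Finset.sum_le_sum fun m hm => ?_
      have hm := Finset.mem_range.1 hm
      have h1 : σ m * E m ≤ P m := calc
        σ m * E m ≤ |σ m| * |E m| := (le_abs_self _).trans (abs_mul _ _).le
        _ ≤ 1 * |E m| := by gcongr; exact hσ m hm
        _ ≤ P m := by rw [one_mul]; exact hP m
      have h2 : P (m + 1) = P m + |E (m + 1) - E m| := Finset.sum_range_succ _ _
      have h3 := mul_le_mul_of_nonneg_left h1 (sub_nonneg.2 (hb m hm))
      rw [h2, ← hδ m hm]
      linear_combination h3

theorem sum_sign_mul_weighted_pos_of_monotone {N : ℕ} {E b σ : ℕ → ℝ} (hEN : E N = 0)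
    (hσ : ∀ m < N, |σ m| ≤ 1) (hδ : ∀ m < N, σ m * (E (m + 1) - E m) = |E (m + 1) - E m|)
    (hb : ∀ m < N, b m ≤ b (m + 1)) (hb0 : 0 < b 0)
    (hpos : 0 < ∑ m ∈ Finset.range N, |E (m + 1) - E m|) :
    0 < ∑ m ∈ Finset.range N, σ m * (b (m + 1) * E (m + 1) - b m * E m) := by
  set Q : ℕ → ℝ := fun m => ∑ i ∈ Finset.Ico m N, |E (i + 1) - E i|
  have hQ {m : ℕ} (hm : m ≤ N) : |E m| ≤ Q m := by
    simpa [hEN] using abs_sub_le_sum_abs_succ_sub E hm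
  calc 0 < -(b N * Q N - b 0 * Q 0) := by
        simpa [Q] using mul_pos hb0 hpos
    _ = ∑ m ∈ Finset.range N, -(b (m + 1) * Q (m + 1) - b m * Q m) := by
      rw [Finset.sum_neg_distrib, Finset.sum_range_sub (fun m => b m * Q m) N]
    _ ≤ _ := by
      refine Finset.sum_le_sum fun m hm => ?_
      have hm := Finset.mem_range.1 hm
      have h1 : -(σ m * E (m + 1)) ≤ Q (m + 1) := calc
        -(σ m * E (m + 1)) ≤ |σ m| * |E (m + 1)| := (neg_le_abs _).trans (abs_mul _ _).le
        _ ≤ 1 * |E (m + 1)| := by gcongr; exact hσ m hm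
        _ ≤ Q (m + 1) := by rw [one_mul]; exact hQ (by omega)
      have h2 : Q m = |E (m + 1) - E m| + Q (m + 1) := Finset.sum_eq_sum_Ico_succ_bot hm _
      have h3 := mul_le_mul_of_nonneg_left h1 (sub_nonneg.2 (hb m hm))
      rw [h2, ← hδ m hm]
      linear_combination h3

/-- Mean of a function along the segment from `z` to `y`. -/
def segmentMean (g : ℝ → ℝ) (y z : ℝ) : ℝ :=
  ∫ s in (0 : ℝ)..1, g (z + s * (y - z))

theorem segment_mem_Ioo {a b y z s : ℝ} (hy : y ∈ Ioo a b) (hz : z ∈ Ioo a b)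
    (hs : s ∈ Icc (0 : ℝ) 1) : z + s * (y - z) ∈ Ioo a b :=
  (convex_Ioo a b).add_smul_sub_mem hz hy hs

theorem continuousOn_segment {g : ℝ → ℝ} {a b y z : ℝ} (hg : ContinuousOn g (Ioo a b))
    (hy : y ∈ Ioo a b) (hz : z ∈ Ioo a b) :
    ContinuousOn (fun s => g (z + s * (y - z))) (Icc 0 1) :=
  hg.comp (by fun_prop) fun _ hs => segment_mem_Ioo hy hz hs

theorem intervalIntegrable_segment {g : ℝ → ℝ} {a b y z : ℝ} (hg : ContinuousOn g (Ioo a b))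
    (hy : y ∈ Ioo a b) (hz : z ∈ Ioo a b) :
    IntervalIntegrable (fun s => g (z + s * (y - z))) MeasureTheory.volume 0 1 :=
  (continuousOn_segment hg hy hz).intervalIntegrable_of_Icc zero_le_one

theorem sub_eq_segmentMean_mul {f g : ℝ → ℝ} {a b y z : ℝ}
    (hf : ∀ θ ∈ Ioo a b, HasDerivAt f (g θ) θ) (hg : ContinuousOn g (Ioo a b))
    (hy : y ∈ Ioo a b) (hz : z ∈ Ioo a b) :
    f y - f z = segmentMean g y z * (y - z) := by
  rw [segmentMean, ← intervalIntegral.integral_mul_const,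
    intervalIntegral.integral_eq_sub_of_hasDerivAt (f := fun s => f (z + s * (y - z)))]
  · simp
  · intro s hs
    rw [uIcc_of_le zero_le_one] at hs
    have hl : HasDerivAt (fun s : ℝ => z + s * (y - z)) (y - z) s := by
      simpa using ((hasDerivAt_id s).mul_const (y - z)).const_add z
    exact (hf _ (segment_mem_Ioo hy hz hs)).comp s hl
  · exact (intervalIntegrable_segment hg hy hz).mul_const _

theorem segmentMean_neg_of_neg {g : ℝ → ℝ} {a b y z : ℝ} (hg : ContinuousOn g (Ioo a b))
    (hneg : ∀ θ ∈ Ioo a b, g θ < 0) (hy : y ∈ Ioo a b) (hz : z ∈ Ioo a b) :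
    segmentMean g y z < 0 := by
  have h := intervalIntegral.intervalIntegral_pos_of_pos_on
    (intervalIntegrable_segment hg hy hz).neg
    (fun s hs => neg_pos.2 (hneg _ (segment_mem_Ioo hy hz (Ioo_subset_Icc_self hs)))) one_pos
  have h' : ∫ s in (0 : ℝ)..1, -g (z + s * (y - z)) = -segmentMean g y z :=
    intervalIntegral.integral_neg
  simp only [Pi.neg_apply] at h
  linarith

theorem segment_le_segment {y z y' z' s : ℝ} (hyy : y ≤ y') (hzz : z ≤ z')
    (hs : s ∈ Icc (0 : ℝ) 1) : z + s * (y - z) ≤ z' + s * (y' - z') := by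
  nlinarith [mul_nonneg hs.1 (sub_nonneg.2 hyy),
    mul_nonneg (sub_nonneg.2 hs.2) (sub_nonneg.2 hzz)]

theorem segmentMean_le_of_monotoneOn {g : ℝ → ℝ} {a b y z y' z' : ℝ}
    (hg : ContinuousOn g (Ioo a b)) (hmono : MonotoneOn g (Ioo a b))
    (hy : y ∈ Ioo a b) (hz : z ∈ Ioo a b) (hy' : y' ∈ Ioo a b) (hz' : z' ∈ Ioo a b)
    (hyy : y ≤ y') (hzz : z ≤ z') : segmentMean g y z ≤ segmentMean g y' z' :=
  intervalIntegral.integral_mono_on zero_le_one (intervalIntegrable_segment hg hy hz)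
    (intervalIntegrable_segment hg hy' hz') fun _ hs =>
      hmono (segment_mem_Ioo hy hz hs) (segment_mem_Ioo hy' hz' hs) (segment_le_segment hyy hzz hs)

theorem segmentMean_le_of_antitoneOn {g : ℝ → ℝ} {a b y z y' z' : ℝ}
    (hg : ContinuousOn g (Ioo a b)) (hanti : AntitoneOn g (Ioo a b))
    (hy : y ∈ Ioo a b) (hz : z ∈ Ioo a b) (hy' : y' ∈ Ioo a b) (hz' : z' ∈ Ioo a b)
    (hyy : y ≤ y') (hzz : z ≤ z') : segmentMean g y' z' ≤ segmentMean g y z :=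
  intervalIntegral.integral_mono_on zero_le_one (intervalIntegrable_segment hg hy' hz')
    (intervalIntegrable_segment hg hy hz) fun _ hs =>
      hanti (segment_mem_Ioo hy hz hs) (segment_mem_Ioo hy' hz' hs)
        (segment_le_segment hyy hzz hs)

theorem Function.Periodic.sum_range_add {N : ℕ} {h : ℕ → ℝ} (hh : Function.Periodic h N) (j : ℕ) :
    ∑ m ∈ Finset.range N, h (j + m) = ∑ m ∈ Finset.range N, h m := by
  induction j with
  | zero => simp
  | succ j ih =>
    rw [← ih]
    have h1 := Finset.sum_range_succ (fun m => h (j + m)) N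
    rw [Finset.sum_range_succ', hh j, add_zero] at h1
    simpa [add_assoc, add_comm 1] using h1

/-- Contribution of the coupling to oscillator `j` to the derivative of the distance. -/
theorem sum_sign_mul_coupling_neg {N : ℕ} (hN : 2 ≤ N) {Γ Γ' : ℝ → ℝ}
    (hper : ∀ θ : ℝ, Γ (θ + 2 * π) = Γ θ)
    (hd1 : ∀ θ ∈ Ioo (0 : ℝ) (2 * π), HasDerivAt Γ (Γ' θ) θ)
    (hcont : ContinuousOn Γ' (Ioo 0 (2 * π)))
    (hneg : ∀ θ ∈ Ioo (0 : ℝ) (2 * π), Γ' θ < 0)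
    (hcurv : MonotoneOn Γ' (Ioo 0 (2 * π)) ∨ AntitoneOn Γ' (Ioo 0 (2 * π)))
    {x y : ℕ → ℝ} (hx : inCone N x) (hy : inCone N y) {D f σ : ℕ → ℝ} (j : ℕ)
    (hD : ∀ k, D k = circleLift N x k - circleLift N y k)
    (hf : ∀ k, f k = Γ (circleLift N x k - circleLift N x j)
      - Γ (circleLift N y k - circleLift N y j))
    (hσper : Function.Periodic σ N) (hσ : ∀ k, |σ k| ≤ 1)
    (hσD : ∀ k, σ k * (D (k + 1) - D k) = |D (k + 1) - D k|)
    (hpos : 0 < ∑ k ∈ Finset.range N, |D (k + 1) - D k|) :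
    ∑ k ∈ Finset.range N, σ k * (f (k + 1) - f k) < 0 := by
  have hN0 : 0 < N := by omega
  have hDper : Function.Periodic D N := fun k => by
    rw [hD, hD, circleLift_add hN0, circleLift_add hN0]; ring
  have hfper : Function.Periodic f N := fun k => by
    rw [hf, hf, circleLift_add hN0, circleLift_add hN0, add_sub_right_comm, add_sub_right_comm,
      hper, hper]
  set c : ℕ → ℕ := fun m => max 1 (min m (N - 1)) with hc
  set u : ℕ → ℝ := fun m => circleLift N x (j + c m) - circleLift N x j with hu
  set v : ℕ → ℝ := fun m => circleLift N y (j + c m) - circleLift N y j with hv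
  set b : ℕ → ℝ := fun m => -segmentMean Γ' (u m) (v m) with hb
  set E : ℕ → ℝ := fun m => D (j + m) - D j with hE
  have hcm (m : ℕ) : 0 < c m ∧ c m < N := by simp only [hc]; omega
  have hcs (m : ℕ) : j + c m ≤ j + c (m + 1) := by simp only [hc]; omega
  have hum (m : ℕ) : u m ∈ Ioo 0 (2 * π) := circleLift_sub_mem_Ioo hN hx j (hcm m).1 (hcm m).2
  have hvm (m : ℕ) : v m ∈ Ioo 0 (2 * π) := circleLift_sub_mem_Ioo hN hy j (hcm m).1 (hcm m).2
  have hus (m : ℕ) : u m ≤ u (m + 1) :=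
    sub_le_sub_right ((circleLift_strictMono hN hx).monotone (hcs m)) _
  have hvs (m : ℕ) : v m ≤ v (m + 1) :=
    sub_le_sub_right ((circleLift_strictMono hN hy).monotone (hcs m)) _
  have hbpos (m : ℕ) : 0 < b m := neg_pos.2 (segmentMean_neg_of_neg hcont hneg (hum m) (hvm m))
  have hE0 : E 0 = 0 := by simp [hE]
  have hEN : E N = 0 := by simp [hE, hDper j]
  have hfE {m : ℕ} (hm : m ≤ N) : f (j + m) = -(b m * E m) := by
    have hfj : f j = 0 := by simp [hf]
    by_cases h : 0 < m ∧ m < N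
    · have hcmm : c m = m := by simp only [hc]; omega
      have := sub_eq_segmentMean_mul hd1 hcont (hum m) (hvm m)
      have huv : u m - v m = E m := by simp only [hu, hv, hE, hcmm, hD]; ring
      rw [huv] at this
      rw [hf, hb, neg_mul, neg_neg, ← this]
      simp only [hu, hv, hcmm]
    · obtain rfl | rfl : m = 0 ∨ m = N := by omega
      · simp [hfj, hE0]
      · rw [hfper, hfj, hEN]; simp
  have hEs (m : ℕ) : E (m + 1) - E m = D (j + m + 1) - D (j + m) := by
    simp only [hE, add_assoc]; ring
  have hEpos : 0 < ∑ m ∈ Finset.range N, |E (m + 1) - E m| := by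
    have hp : Function.Periodic (fun k => |D (k + 1) - D k|) N := fun k => by
      simp only [add_right_comm k N 1, hDper _]
    simp only [hEs]
    rwa [hp.sum_range_add j]
  have hEσ (m : ℕ) : σ (j + m) * (E (m + 1) - E m) = |E (m + 1) - E m| := by
    rw [hEs]; exact hσD _
  have key : 0 < ∑ m ∈ Finset.range N, σ (j + m) * (b (m + 1) * E (m + 1) - b m * E m) := by
    rcases hcurv with h | h
    · refine sum_sign_mul_weighted_pos_of_antitone (σ := fun m => σ (j + m)) hE0
        (fun m _ => hσ _) (fun m _ => hEσ m) (fun m _ => ?_) (hbpos N) hEpos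
      exact neg_le_neg (segmentMean_le_of_monotoneOn hcont h (hum _) (hvm _) (hum _) (hvm _)
        (hus m) (hvs m))
    · refine sum_sign_mul_weighted_pos_of_monotone (σ := fun m => σ (j + m)) hEN
        (fun m _ => hσ _) (fun m _ => hEσ m) (fun m _ => ?_) (hbpos 0) hEpos
      exact neg_le_neg (segmentMean_le_of_antitoneOn hcont h (hum _) (hvm _) (hum _) (hvm _)
        (hus m) (hvs m))
  have hp : Function.Periodic (fun k => σ k * (f (k + 1) - f k)) N := fun k => by
    simp only [add_right_comm k N 1, hfper _, hσper _]
  rw [← hp.sum_range_add j, ← neg_pos, ← Finset.sum_neg_distrib]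
  refine key.trans_eq (Finset.sum_congr rfl fun m hm => ?_)
  have hm := Finset.mem_range.1 hm
  rw [add_assoc, hfE hm.le, hfE (show m + 1 ≤ N by omega)]
  ring

/-- Sign of `a`, or of `b` if `a` vanishes: the sign of `a + ε * b` for small `ε > 0`. -/
def sideSign (a b : ℝ) : ℝ :=
  if a = 0 then (SignType.sign b : ℝ) else (SignType.sign a : ℝ)

theorem abs_sideSign_le_one (a b : ℝ) : |sideSign a b| ≤ 1 := by
  have h (c : ℝ) : |(SignType.sign c : ℝ)| ≤ 1 := by
    rcases lt_trichotomy c 0 with h | h | h <;> simp [h]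
  unfold sideSign
  split_ifs <;> exact h _

theorem sideSign_mul_self (a b : ℝ) : sideSign a b * a = |a| := by
  unfold sideSign
  split_ifs with h
  · simp [h]
  · exact sign_mul_self a

theorem HasDerivAt.abs_right {u : ℝ → ℝ} {u' t : ℝ} (hu : HasDerivAt u u' t) :
    HasDerivWithinAt (fun s => |u s|) (sideSign (u t) u' * u') (Ici t) t := by
  by_cases h : u t = 0
  · rw [sideSign, if_pos h, sign_mul_self, ← hasDerivWithinAt_Ioi_iff_Ici,
      hasDerivWithinAt_iff_tendsto_slope' self_notMem_Ioi]
    have h1 := ((hasDerivWithinAt_iff_tendsto_slope' self_notMem_Ioi).1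
      (hu.hasDerivWithinAt (s := Ioi t))).abs
    refine h1.congr' ?_
    filter_upwards [self_mem_nhdsWithin] with s hs
    have hs : 0 < s - t := sub_pos.2 hs
    simp [slope_def_field, h, abs_div, abs_of_pos hs]
  · rw [sideSign, if_neg h]
    exact ((hasDerivAt_abs h).comp t hu).hasDerivWithinAt

theorem strictAntiOn_of_hasDerivWithinAt_right_neg {F F' : ℝ → ℝ} {I : Set ℝ} (hI : I.OrdConnected)
    (hF : ContinuousOn F I) (hF' : ∀ t ∈ I, HasDerivWithinAt F (F' t) (Ici t) t)
    (hneg : ∀ t ∈ I, F' t < 0) : StrictAntiOn F I := by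
  have hanti : AntitoneOn F I := by
    intro a ha b hb hab
    have hsub : Icc a b ⊆ I := hI.out ha hb
    refine image_le_of_liminf_slope_right_lt_deriv_boundary (f' := F') (B := fun _ => F a)
      (B' := fun _ => 0) (hF.mono hsub) (fun s hs r hr => ?_) le_rfl
      (fun s => hasDerivAt_const s _) (fun s hs _ => hneg s (hsub (Ico_subset_Icc_self hs)))
      ⟨hab, le_rfl⟩
    exact (hF' s (hsub (Ico_subset_Icc_self hs))).liminf_right_slope_le hr
  intro a ha b hb hab
  have h := (hasDerivWithinAt_iff_tendsto_slope' self_notMem_Ioi).1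
    (hasDerivWithinAt_Ioi_iff_Ici.2 (hF' a ha))
  obtain ⟨s, hs, hsab⟩ :=
    ((h.eventually_lt_const (hneg a ha)).and (Ioo_mem_nhdsGT hab)).exists
  have hlt : F s < F a := by
    rw [slope_def_field, div_lt_iff₀ (sub_pos.2 hsab.1)] at hs
    linarith
  exact (hanti (hI.out ha hb (Ioo_subset_Icc_self hsab)) hb hsab.2.le).trans_lt hlt


/-- Contraction of monotone phase-coupled oscillators (decreasing coupling function):
the total-variation distance between any two distinct orbits in the open cone `C`
is strictly decreasing. -/
theorem contraction_of_decreasing_coupling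
    (N : ℕ) (hN : 2 ≤ N) (Γ Γ' Γ'' : ℝ → ℝ)
    (hper : ∀ θ : ℝ, Γ (θ + 2 * π) = Γ θ)
    (hd1 : ∀ θ ∈ Ioo (0 : ℝ) (2 * π), HasDerivAt Γ (Γ' θ) θ)
    (hd2 : ∀ θ ∈ Ioo (0 : ℝ) (2 * π), HasDerivAt Γ' (Γ'' θ) θ)
    (hmono : ∀ θ ∈ Ioo (0 : ℝ) (2 * π), Γ' θ < 0)
    (hcurv : (∀ θ ∈ Ioo (0 : ℝ) (2 * π), 0 ≤ Γ'' θ) ∨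
      (∀ θ ∈ Ioo (0 : ℝ) (2 * π), Γ'' θ ≤ 0))
    (I : Set ℝ) (hI : I.OrdConnected)
    (Θ Ψ : ℝ → ℕ → ℝ)
    (hΘ : IsSolFull N Γ I Θ) (hΨ : IsSolFull N Γ I Ψ)
    (hΘC : ∀ t ∈ I, inCone N (Θ t)) (hΨC : ∀ t ∈ I, inCone N (Ψ t))
    (hne : ∀ t ∈ I, ∃ k ∈ Finset.Icc 1 (N - 1), Θ t k ≠ Ψ t k) :
    ∀ t₁ ∈ I, ∀ t₂ ∈ I, t₁ < t₂ →
      dist1 1 (N - 1) (Θ t₂) (Ψ t₂) < dist1 1 (N - 1) (Θ t₁) (Ψ t₁) := by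
  have hN0 : 0 < N := by omega
  have hcont : ContinuousOn Γ' (Ioo 0 (2 * π)) := fun θ hθ =>
    (hd2 θ hθ).continuousAt.continuousWithinAt
  have hcurv' : MonotoneOn Γ' (Ioo 0 (2 * π)) ∨ AntitoneOn Γ' (Ioo 0 (2 * π)) := by
    have hdiff : DifferentiableOn ℝ Γ' (interior (Ioo 0 (2 * π))) := fun θ hθ =>
      (hd2 θ (interior_subset hθ)).differentiableAt.differentiableWithinAt
    refine hcurv.imp (fun h => ?_) fun h => ?_
    · refine monotoneOn_of_deriv_nonneg (convex_Ioo _ _) hcont hdiff fun θ hθ => ?_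
      rw [(hd2 θ (interior_subset hθ)).deriv]
      exact h θ (interior_subset hθ)
    · refine antitoneOn_of_deriv_nonpos (convex_Ioo _ _) hcont hdiff fun θ hθ => ?_
      rw [(hd2 θ (interior_subset hθ)).deriv]
      exact h θ (interior_subset hθ)
  set D : ℝ → ℕ → ℝ := fun t k => circleLift N (Θ t) k - circleLift N (Ψ t) k with hD
  set f : ℝ → ℕ → ℕ → ℝ := fun t j k => Γ (circleLift N (Θ t) k - circleLift N (Θ t) j)
    - Γ (circleLift N (Ψ t) k - circleLift N (Ψ t) j) with hf
  set δ' : ℝ → ℕ → ℝ := fun t k => ∑ j ∈ Finset.range N, (f t j (k + 1) - f t j k) with hδ'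
  set σ : ℝ → ℕ → ℝ := fun t k => sideSign (D t (k + 1) - D t k) (δ' t k) with hσ
  have hDper (t : ℝ) : Function.Periodic (D t) N := fun k => by
    simp only [hD, circleLift_add hN0]; ring
  have hfper (t : ℝ) (j : ℕ) : Function.Periodic (f t j) N := fun k => by
    simp only [hf, circleLift_add hN0, add_sub_right_comm, hper]
  have hσper (t : ℝ) : Function.Periodic (σ t) N := fun k => by
    simp only [hσ, hδ', add_right_comm k N 1, hDper t _, hfper t _ _]
  have hδ {t : ℝ} (ht : t ∈ I) {k : ℕ} (hk : k < N) :
      HasDerivAt (fun s => D s (k + 1) - D s k) (δ' t k) t := by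
    have hd {l : ℕ} (hl : l ≤ N) := (hasDerivAt_circleLift hN hper hΘ ht hl).sub
      (hasDerivAt_circleLift hN hper hΨ ht hl)
    refine ((hd (show k + 1 ≤ N by omega)).sub (hd hk.le)).congr_deriv ?_
    simp only [hδ', hf, liftVelocity, Finset.sum_sub_distrib]
    ring
  have hdist : (fun t => dist1 1 (N - 1) (Θ t) (Ψ t)) =
      fun t => ∑ k ∈ Finset.range N, |D t (k + 1) - D t k| :=
    funext fun t => dist1_eq_sum_circleLift hN _ _
  have hderiv : ∀ t ∈ I, HasDerivWithinAt (fun t => ∑ k ∈ Finset.range N, |D t (k + 1) - D t k|)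
      (∑ k ∈ Finset.range N, σ t k * δ' t k) (Ici t) t := fun t ht =>
    HasDerivWithinAt.fun_sum fun k hk => (hδ ht (Finset.mem_range.1 hk)).abs_right
  have hneg : ∀ t ∈ I, ∑ k ∈ Finset.range N, σ t k * δ' t k < 0 := by
    intro t ht
    have hpos : 0 < ∑ k ∈ Finset.range N, |D t (k + 1) - D t k| := by
      obtain ⟨k, hk, hne⟩ := hne t ht
      have hkN : k ≤ N := by rw [Finset.mem_Icc] at hk; omega
      have hDk : 0 < |D t k - D t 0| := by
        simpa only [hD, circleLift_zero, circleLift_of_mem hk, sub_zero, abs_pos, sub_ne_zero]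
      refine hDk.trans_le ((abs_sub_le_sum_abs_succ_sub (D t) (Nat.zero_le k)).trans ?_)
      rw [← Finset.range_eq_Ico]
      exact Finset.sum_le_sum_of_subset_of_nonneg (Finset.range_mono hkN)
        fun _ _ _ => abs_nonneg _
    simp only [hδ', Finset.mul_sum]
    rw [Finset.sum_comm]
    refine Finset.sum_neg (fun j _ => ?_) (Finset.nonempty_range_iff.2 hN0.ne')
    exact sum_sign_mul_coupling_neg hN hper hd1 hcont hmono hcurv' (hΘC t ht) (hΨC t ht) j
      (fun _ => rfl) (fun _ => rfl) (hσper t) (fun _ => abs_sideSign_le_one _ _)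
      (fun _ => sideSign_mul_self _ _) hpos
  have hanti := strictAntiOn_of_hasDerivWithinAt_right_neg hI
    (fun t ht => (tendsto_finsetSum _ fun k hk =>
      (hδ ht (Finset.mem_range.1 hk)).continuousAt.abs.continuousWithinAt)) hderiv hneg
  rw [← hdist] at hanti
  exact fun t₁ h₁ t₂ h₂ h => hanti h₁ h₂ h
end
end

section
/- Let N ≥ 2 and let Γ : ℝ → ℝ be 2π-periodic, twice differentiable on (0, 2π), with Γ′(θ) > 0 for every θ ∈ (0, 2π), and with second derivative of constant sign on (0, 2π) (either Γ″(θ) ≥ 0 for every θ ∈ (0, 2π) or Γ″(θ) ≤ 0 for every θ ∈ (0, 2π)). Let I ⊆ ℝ be an interval and let Θ, Ψ : I → ℝ^{N−1} be solutions of the phase-difference dynamics on I such that Θ(t) ∈ C, Ψ(t) ∈ C and Θ(t) ≠ Ψ(t) for every t ∈ I. Then the function t ↦ ‖Θ(t) − Ψ(t)‖_{(1)} is strictly increasing on I, i.e. for all t₁, t₂ ∈ I with t₁ < t₂ one has ‖Θ(t₂) − Ψ(t₂)‖_{(1)} > ‖Θ(t₁) − Ψ(t₁)‖_{(1)}. 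-/
open Real Filter Set Topology

noncomputable section

/-- The divided difference of a function with derivative `f'`, as an average of `f'`. -/
def meanSlope (f' : ℝ → ℝ) (p r : ℝ) : ℝ := ∫ t in (0 : ℝ)..1, f' (r + t * (p - r))

theorem continuousOn_segment_s1 {f' : ℝ → ℝ} {s : Set ℝ} (hs : Convex ℝ s)
    (hf' : ContinuousOn f' s) {p r : ℝ} (hp : p ∈ s) (hr : r ∈ s) :
    ContinuousOn (fun t => f' (r + t * (p - r))) (uIcc 0 1) := by
  refine hf'.comp (by fun_prop) fun t ht => ?_
  rw [uIcc_of_le zero_le_one] at ht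
  exact hs.add_smul_sub_mem hr hp ht

theorem sub_eq_meanSlope_mul {f f' : ℝ → ℝ} {s : Set ℝ} (hs : Convex ℝ s)
    (hf : ∀ x ∈ s, HasDerivAt f (f' x) x) (hf' : ContinuousOn f' s) {p r : ℝ}
    (hp : p ∈ s) (hr : r ∈ s) : f p - f r = meanSlope f' p r * (p - r) := by
  have hcont : ContinuousOn (fun t => f' (r + t * (p - r)) * (p - r)) (uIcc 0 1) :=
    (continuousOn_segment_s1 hs hf' hp hr).mul continuousOn_const
  rw [meanSlope, ← intervalIntegral.integral_mul_const,
    intervalIntegral.integral_eq_sub_of_hasDerivAt (f := fun t => f (r + t * (p - r)))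
      (fun t ht => ?_) hcont.intervalIntegrable]
  · simp
  · rw [uIcc_of_le zero_le_one] at ht
    have h : HasDerivAt (fun t => r + t * (p - r)) (p - r) t := by
      simpa using ((hasDerivAt_id t).mul_const (p - r)).const_add r
    exact (hf _ (hs.add_smul_sub_mem hr hp ht)).comp t h

theorem meanSlope_pos {f' : ℝ → ℝ} {s : Set ℝ} (hs : Convex ℝ s) (hf' : ContinuousOn f' s)
    (hpos : ∀ x ∈ s, 0 < f' x) {p r : ℝ} (hp : p ∈ s) (hr : r ∈ s) : 0 < meanSlope f' p r :=
  intervalIntegral.intervalIntegral_pos_of_pos_on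
    (continuousOn_segment_s1 hs hf' hp hr).intervalIntegrable
    (fun _ ht => hpos _ (hs.add_smul_sub_mem hr hp (Ioo_subset_Icc_self ht))) zero_lt_one

theorem meanSlope_mono {f' : ℝ → ℝ} {s : Set ℝ} (hs : Convex ℝ s) (hf' : ContinuousOn f' s)
    (hmono : MonotoneOn f' s) {p r p' r' : ℝ} (hp : p ∈ s) (hr : r ∈ s) (hp' : p' ∈ s)
    (hr' : r' ∈ s) (hpp : p ≤ p') (hrr : r ≤ r') : meanSlope f' p r ≤ meanSlope f' p' r' :=
  intervalIntegral.integral_mono_on zero_le_one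
    (continuousOn_segment_s1 hs hf' hp hr).intervalIntegrable
    (continuousOn_segment_s1 hs hf' hp' hr').intervalIntegrable fun t ht =>
      hmono (hs.add_smul_sub_mem hr hp ht) (hs.add_smul_sub_mem hr' hp' ht) <| by
        have h1 := mul_le_mul_of_nonneg_left hpp ht.1
        have h2 := mul_le_mul_of_nonneg_left hrr (sub_nonneg.2 ht.2)
        simp only [smul_eq_mul]
        linarith

theorem meanSlope_anti {f' : ℝ → ℝ} {s : Set ℝ} (hs : Convex ℝ s) (hf' : ContinuousOn f' s)
    (hanti : AntitoneOn f' s) {p r p' r' : ℝ} (hp : p ∈ s) (hr : r ∈ s) (hp' : p' ∈ s)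
    (hr' : r' ∈ s) (hpp : p ≤ p') (hrr : r ≤ r') : meanSlope f' p' r' ≤ meanSlope f' p r := by
  have h := meanSlope_mono hs hf'.neg hanti.neg hp hr hp' hr' hpp hrr
  simpa [meanSlope] using h

theorem abs_sub_le_sum_abs (e : ℕ → ℝ) (n : ℕ) :
    |e n - e 0| ≤ ∑ i ∈ Finset.range n, |e (i + 1) - e i| := by
  rw [← Finset.sum_range_sub]
  exact Finset.abs_sum_le_sum_abs _ _

theorem mul_sum_abs_le_of_antitone {e a s : ℕ → ℝ} (he : e 0 = 0) (ha : Antitone a)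
    (hs : ∀ i, |s i| ≤ 1) (hse : ∀ i, s i * (e (i + 1) - e i) = |e (i + 1) - e i|) (n : ℕ) :
    a n * ∑ i ∈ Finset.range n, |e (i + 1) - e i| ≤
      ∑ i ∈ Finset.range n, s i * (a (i + 1) * e (i + 1) - a i * e i) := by
  induction n with
  | zero => simp
  | succ n ih =>
    rw [Finset.sum_range_succ, Finset.sum_range_succ, ← hse n]
    have h1 : |e n| ≤ ∑ i ∈ Finset.range n, |e (i + 1) - e i| := by
      simpa [he] using abs_sub_le_sum_abs e n
    have h2 : s n * e n ≤ |e n| := by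
      refine (le_abs_self _).trans ?_
      rw [abs_mul]
      exact mul_le_of_le_one_left (abs_nonneg _) (hs n)
    have h3 := mul_le_mul_of_nonneg_left (h2.trans h1) (sub_nonneg.2 (ha n.le_succ))
    linarith

theorem mul_sum_abs_le_of_monotone (n : ℕ) {e a s : ℕ → ℝ} (he : e n = 0) (ha : Monotone a)
    (hs : ∀ i, |s i| ≤ 1) (hse : ∀ i, s i * (e (i + 1) - e i) = |e (i + 1) - e i|) :
    a 0 * ∑ i ∈ Finset.range n, |e (i + 1) - e i| ≤
      ∑ i ∈ Finset.range n, s i * (a (i + 1) * e (i + 1) - a i * e i) := by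
  induction n generalizing e a s with
  | zero => simp
  | succ n ih =>
    have ih := ih (e := fun i => e (i + 1)) (a := fun i => a (i + 1)) (s := fun i => s (i + 1))
      he (fun i j h => ha (by lia)) (fun i => hs _) (fun i => hse _)
    rw [Finset.sum_range_succ', Finset.sum_range_succ', ← hse 0]
    have h1 : |e 1| ≤ ∑ i ∈ Finset.range n, |e (i + 1 + 1) - e (i + 1)| := by
      simpa [he] using abs_sub_le_sum_abs (fun i => e (i + 1)) n
    have h2 : -(s 0 * e 1) ≤ |e 1| := by
      refine (neg_le_abs _).trans ?_
      rw [abs_mul]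
      exact mul_le_of_le_one_left (abs_nonneg _) (hs 0)
    have h3 := mul_le_mul_of_nonneg_left (h2.trans h1) (sub_nonneg.2 (ha (Nat.zero_le 1)))
    simp only [zero_add] at ih ⊢
    linarith

theorem sum_range_add_of_periodic {f : ℕ → ℝ} {N : ℕ} (hf : Function.Periodic f N) (j : ℕ) :
    ∑ i ∈ Finset.range N, f (j + i) = ∑ i ∈ Finset.range N, f i := by
  induction j with
  | zero => simp
  | succ j ih =>
    rw [← ih]
    have h1 := Finset.sum_range_succ (fun i => f (j + i)) N
    have h2 := Finset.sum_range_succ' (fun i => f (j + i)) N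
    have h3 := hf j
    have h4 : ∀ i, f (j + 1 + i) = f (j + (i + 1)) := fun i => by congr 1; ring
    simp only [h4, add_zero] at h1 h2 ⊢
    linarith

theorem sum_sign_mul_pair_pos {N : ℕ} (hN : 2 ≤ N) {Γ Γ' : ℝ → ℝ}
    (hd : ∀ θ ∈ Ioo (0 : ℝ) (2 * π), HasDerivAt Γ (Γ' θ) θ)
    (hcont : ContinuousOn Γ' (Ioo 0 (2 * π)))
    (hpos : ∀ θ ∈ Ioo (0 : ℝ) (2 * π), 0 < Γ' θ)
    (hcurv : MonotoneOn Γ' (Ioo 0 (2 * π)) ∨ AntitoneOn Γ' (Ioo 0 (2 * π)))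
    {X Y s : ℕ → ℝ} (hX : StrictMono X) (hY : StrictMono Y)
    (hXN : X N = X 0 + 2 * π) (hYN : Y N = Y 0 + 2 * π)
    (hs : ∀ i, |s i| ≤ 1)
    (hse : ∀ i, s i * (X (i + 1) - Y (i + 1) - (X i - Y i)) =
      |X (i + 1) - Y (i + 1) - (X i - Y i)|)
    (hne : 0 < ∑ i ∈ Finset.range N, |X (i + 1) - Y (i + 1) - (X i - Y i)|) :
    0 < ∑ i ∈ Finset.range N, s i *
      (Γ (X (i + 1) - X 0) - Γ (Y (i + 1) - Y 0) - (Γ (X i - X 0) - Γ (Y i - Y 0))) := by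
  let c : ℕ → ℕ := fun i => max 1 (min i (N - 1))
  have hc : Monotone c := fun i j h => max_le_max le_rfl (min_le_min h le_rfl)
  have mem : ∀ Z : ℕ → ℝ, StrictMono Z → Z N = Z 0 + 2 * π → ∀ i,
      Z (c i) - Z 0 ∈ Ioo (0 : ℝ) (2 * π) := fun Z hZ hZN i =>
    ⟨sub_pos.2 (hZ (by simp only [c]; lia)), by
      have := hZ (show c i < N by simp only [c]; lia)
      linarith⟩
  have mX := mem X hX hXN
  have mY := mem Y hY hYN
  have hs_conv : Convex ℝ (Ioo (0 : ℝ) (2 * π)) := convex_Ioo _ _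
  let a : ℕ → ℝ := fun i => meanSlope Γ' (X (c i) - X 0) (Y (c i) - Y 0)
  let e : ℕ → ℝ := fun i => X i - X 0 - (Y i - Y 0)
  have ha_pos : ∀ i, 0 < a i := fun i => meanSlope_pos hs_conv hcont hpos (mX i) (mY i)
  have he0 : e 0 = 0 := by simp [e]
  have heN : e N = 0 := by simp only [e]; linarith
  have hee : ∀ i, e (i + 1) - e i = X (i + 1) - Y (i + 1) - (X i - Y i) := fun i => by
    simp only [e]; ring
  have hg : ∀ i ≤ N, Γ (X i - X 0) - Γ (Y i - Y 0) = a i * e i := by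
    intro i hi
    rcases Nat.eq_zero_or_pos i with rfl | h0
    · simp [he0]
    rcases hi.eq_or_lt with rfl | h1
    · simp [heN, hXN, hYN]
    have hci : c i = i := by simp only [c]; lia
    have h := sub_eq_meanSlope_mul hs_conv hd hcont (mX i) (mY i)
    simp only [a, e]
    rwa [hci] at h ⊢
  have hsum : ∑ i ∈ Finset.range N, s i *
      (Γ (X (i + 1) - X 0) - Γ (Y (i + 1) - Y 0) - (Γ (X i - X 0) - Γ (Y i - Y 0))) =
      ∑ i ∈ Finset.range N, s i * (a (i + 1) * e (i + 1) - a i * e i) :=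
    Finset.sum_congr rfl fun i hi => by
      have hi := Finset.mem_range.1 hi
      rw [hg _ hi, hg _ hi.le]
  simp only [← hee] at hse hne
  rw [hsum]
  have mono : ∀ {i j}, i ≤ j → X (c i) - X 0 ≤ X (c j) - X 0 ∧ Y (c i) - Y 0 ≤ Y (c j) - Y 0 :=
    fun h => ⟨sub_le_sub_right (hX.monotone (hc h)) _, sub_le_sub_right (hY.monotone (hc h)) _⟩
  rcases hcurv with hm | hm
  · refine (mul_pos (ha_pos 0) hne).trans_le
      (mul_sum_abs_le_of_monotone N heN (fun i j h => ?_) hs hse)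
    exact meanSlope_mono hs_conv hcont hm (mX i) (mY i) (mX j) (mY j) (mono h).1 (mono h).2
  · refine (mul_pos (ha_pos N) hne).trans_le
      (mul_sum_abs_le_of_antitone he0 (fun i j h => ?_) hs hse N)
    exact meanSlope_anti hs_conv hcont hm (mX i) (mY i) (mX j) (mY j) (mono h).1 (mono h).2

/-- Difference of the velocities of the `k`-th phases in two configurations of `N` oscillators. -/
def velocityDiff (N : ℕ) (Γ : ℝ → ℝ) (X Y : ℕ → ℝ) (k : ℕ) : ℝ :=
  ∑ j ∈ Finset.range N, (Γ (X k - X j) - Γ (Y k - Y j))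

theorem sum_sign_mul_velocityDiff_pos {N : ℕ} (hN : 2 ≤ N) {Γ Γ' : ℝ → ℝ}
    (hper : ∀ θ : ℝ, Γ (θ + 2 * π) = Γ θ)
    (hd : ∀ θ ∈ Ioo (0 : ℝ) (2 * π), HasDerivAt Γ (Γ' θ) θ)
    (hcont : ContinuousOn Γ' (Ioo 0 (2 * π)))
    (hpos : ∀ θ ∈ Ioo (0 : ℝ) (2 * π), 0 < Γ' θ)
    (hcurv : MonotoneOn Γ' (Ioo 0 (2 * π)) ∨ AntitoneOn Γ' (Ioo 0 (2 * π)))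
    {X Y s : ℕ → ℝ} (hX : StrictMono X) (hY : StrictMono Y)
    (hXN : ∀ k, X (k + N) = X k + 2 * π) (hYN : ∀ k, Y (k + N) = Y k + 2 * π)
    (hs : ∀ i, |s i| ≤ 1) (hsN : Function.Periodic s N)
    (hse : ∀ i, s i * (X (i + 1) - Y (i + 1) - (X i - Y i)) =
      |X (i + 1) - Y (i + 1) - (X i - Y i)|)
    (hne : 0 < ∑ i ∈ Finset.range N, |X (i + 1) - Y (i + 1) - (X i - Y i)|) :
    0 < ∑ k ∈ Finset.range N, s k *
      (velocityDiff N Γ X Y (k + 1) - velocityDiff N Γ X Y k) := by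
  simp only [velocityDiff, ← Finset.sum_sub_distrib, Finset.mul_sum]
  rw [Finset.sum_comm]
  have hshift : ∀ k, k + N + 1 = k + 1 + N := fun k => by ring
  have hper' : ∀ x y : ℝ, Γ (x + 2 * π - y) = Γ (x - y) := fun x y => by
    rw [← hper (x - y)]; congr 1; ring
  refine Finset.sum_pos (fun j _ => ?_) ⟨0, Finset.mem_range.2 (by lia)⟩
  rw [← sum_range_add_of_periodic (fun k => by
    simp only [hshift, hXN, hYN, hsN k, hper']) j]
  refine sum_sign_mul_pair_pos hN (X := fun i => X (j + i)) (Y := fun i => Y (j + i))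
    (s := fun i => s (j + i)) hd hcont hpos hcurv (fun _ _ h => hX (by lia))
    (fun _ _ h => hY (by lia)) (hXN j) (hYN j) (fun i => hs _) (fun i => hse _) ?_
  have := sum_range_add_of_periodic
    (f := fun i => |X (i + 1) - Y (i + 1) - (X i - Y i)|) (N := N) (fun k => by
      simp only [hshift, hXN, hYN]; ring_nf) j
  exact hne.trans_eq this.symm

/-- The quasi-periodic extension of the configuration `0, x 1, …, x (N - 1)`. -/
def quasiLift (N : ℕ) (x : ℕ → ℝ) (k : ℕ) : ℝ :=
  (if k % N = 0 then 0 else x (k % N)) + 2 * π * (k / N : ℕ)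

theorem quasiLift_add {N : ℕ} (hN : 0 < N) (x : ℕ → ℝ) (k : ℕ) :
    quasiLift N x (k + N) = quasiLift N x k + 2 * π := by
  simp only [quasiLift, Nat.add_mod_right, Nat.add_div_right k hN, Nat.cast_succ]
  ring

theorem quasiLift_zero (N : ℕ) (x : ℕ → ℝ) : quasiLift N x 0 = 0 := by
  simp [quasiLift]

theorem quasiLift_of_mem {N k : ℕ} (h0 : 0 < k) (hk : k < N) (x : ℕ → ℝ) :
    quasiLift N x k = x k := by
  simp [quasiLift, Nat.mod_eq_of_lt hk, Nat.div_eq_of_lt hk, h0.ne']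

theorem quasiLift_strictMono {N : ℕ} (hN : 2 ≤ N) {x : ℕ → ℝ} (hx : inCone N x) :
    StrictMono (quasiLift N x) := by
  obtain ⟨hx0, hx1, hx2⟩ := hx
  refine strictMono_nat_of_lt_succ fun k => ?_
  induction k using Nat.strong_induction_on with
  | _ k ih =>
    rcases lt_or_ge k N with hk | hk
    · rcases Nat.eq_zero_or_pos k with rfl | h0
      · rwa [quasiLift_zero, quasiLift_of_mem (by lia) (by lia)]
      · rw [quasiLift_of_mem h0 hk]
        rcases Nat.lt_or_ge (k + 1) N with h1 | h1
        · rw [quasiLift_of_mem (by lia) h1]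
          exact hx1 k (Finset.mem_Icc.2 (by lia))
        · obtain rfl : k = N - 1 := by lia
          have h := quasiLift_add (by lia : 0 < N) x 0
          rw [zero_add, quasiLift_zero, zero_add] at h
          rwa [show N - 1 + 1 = N by lia, h]
    · obtain ⟨m, rfl⟩ := Nat.exists_eq_add_of_le' hk
      rw [show m + N + 1 = m + 1 + N by ring, quasiLift_add (by lia), quasiLift_add (by lia)]
      have := ih m (by lia)
      linarith

theorem dist1_eq_sum_quasiLift {N : ℕ} (hN : 2 ≤ N) (x y : ℕ → ℝ) :
    dist1 1 (N - 1) x y = ∑ k ∈ Finset.range N,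
      |quasiLift N x (k + 1) - quasiLift N y (k + 1) - (quasiLift N x k - quasiLift N y k)| := by
  obtain ⟨n, rfl⟩ := Nat.exists_eq_add_of_le' hN
  have hl := fun z : ℕ → ℝ => quasiLift_add (by lia : 0 < n + 2) z 0
  simp only [zero_add, quasiLift_zero] at hl
  rw [Finset.sum_range_succ, Finset.sum_range_succ', hl, hl, quasiLift_zero, quasiLift_zero,
    quasiLift_of_mem (by lia) (by lia), quasiLift_of_mem (by lia) (by lia),
    quasiLift_of_mem (by lia) (by lia), quasiLift_of_mem (by lia) (by lia), dist1,
    show n + 2 - 1 = n + 1 by lia, Nat.add_sub_cancel, ← Finset.Ico_add_one_right_eq_Icc,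
    Finset.sum_Ico_eq_sum_range, Nat.add_sub_cancel]
  have : ∀ i ∈ Finset.range n,
      |quasiLift (n + 2) x (i + 1 + 1) - quasiLift (n + 2) y (i + 1 + 1) -
        (quasiLift (n + 2) x (i + 1) - quasiLift (n + 2) y (i + 1))| =
      |x (1 + i + 1) - y (1 + i + 1) - (x (1 + i) - y (1 + i))| := fun i hi => by
    have hi := Finset.mem_range.1 hi
    rw [quasiLift_of_mem (by lia) (by lia), quasiLift_of_mem (by lia) (by lia),
      quasiLift_of_mem (by lia) (by lia), quasiLift_of_mem (by lia) (by lia), add_comm i 1]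
  rw [Finset.sum_congr rfl this]
  simp only [zero_add, sub_self, sub_zero, zero_sub, abs_neg]
  ring

theorem fullRHS_sub_fullRHS {N : ℕ} (Γ : ℝ → ℝ) (x y : ℕ → ℝ) {k : ℕ}
    (hk : k ∈ Finset.Icc 1 (N - 1)) :
    fullRHS N Γ x k - fullRHS N Γ y k =
      velocityDiff N Γ (quasiLift N x) (quasiLift N y) k -
        velocityDiff N Γ (quasiLift N x) (quasiLift N y) 0 := by
  have hk' := Finset.mem_Icc.1 hk
  have hrange : Finset.range N = insert 0 (Finset.Icc 1 (N - 1)) := by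
    ext i; simp only [Finset.mem_range, Finset.mem_insert, Finset.mem_Icc]; lia
  have hval : ∀ z : ℕ → ℝ, ∀ j ∈ Finset.Icc 1 (N - 1), quasiLift N z j = z j := fun z j hj => by
    have := Finset.mem_Icc.1 hj
    exact quasiLift_of_mem (by lia) (by lia) z
  have hsum : ∀ i, ∑ j ∈ Finset.Icc 1 (N - 1),
      (Γ (quasiLift N x i - quasiLift N x j) - Γ (quasiLift N y i - quasiLift N y j)) =
      ∑ j ∈ Finset.Icc 1 (N - 1), (Γ (quasiLift N x i - x j) - Γ (quasiLift N y i - y j)) :=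
    fun i => Finset.sum_congr rfl fun j hj => by rw [hval x j hj, hval y j hj]
  have hx := Finset.add_sum_erase _ (fun j => Γ (x k - x j)) hk
  have hy := Finset.add_sum_erase _ (fun j => Γ (y k - y j)) hk
  simp only [sub_self] at hx hy
  simp only [velocityDiff, hrange]
  rw [Finset.sum_insert (by simp), Finset.sum_insert (by simp), hsum, hsum]
  simp only [hval x k hk, hval y k hk, quasiLift_zero, sub_zero, zero_sub, sub_self,
    Finset.sum_sub_distrib, fullRHS]
  linarith

theorem hasDerivAt_quasiLift_sub {N : ℕ} (hN : 2 ≤ N) {Γ : ℝ → ℝ}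
    (hper : ∀ θ : ℝ, Γ (θ + 2 * π) = Γ θ) {I : Set ℝ} {Θ Ψ : ℝ → ℕ → ℝ}
    (hΘ : IsSolFull N Γ I Θ) (hΨ : IsSolFull N Γ I Ψ) {t : ℝ} (ht : t ∈ I) (k : ℕ) :
    HasDerivAt (fun s => quasiLift N (Θ s) k - quasiLift N (Ψ s) k)
      (velocityDiff N Γ (quasiLift N (Θ t)) (quasiLift N (Ψ t)) k -
        velocityDiff N Γ (quasiLift N (Θ t)) (quasiLift N (Ψ t)) 0) t := by
  have hvel : Function.Periodic
      (velocityDiff N Γ (quasiLift N (Θ t)) (quasiLift N (Ψ t))) N := fun k => by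
    have hper' : ∀ x y : ℝ, Γ (x + 2 * π - y) = Γ (x - y) := fun x y => by
      rw [← hper (x - y)]; congr 1; ring
    simp only [velocityDiff, quasiLift_add (by lia : 0 < N), hper']
  rw [← hvel.map_mod_nat k]
  by_cases h0 : k % N = 0
  · simp only [quasiLift, h0, if_true, sub_self]
    exact hasDerivAt_const _ _
  · have hk : k % N ∈ Finset.Icc 1 (N - 1) := by
      have := Nat.mod_lt k (by lia : 0 < N)
      exact Finset.mem_Icc.2 (by lia)
    rw [← fullRHS_sub_fullRHS Γ _ _ hk]
    simp only [quasiLift, h0, if_false, add_sub_add_right_eq_sub]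
    exact (hΘ _ hk t ht).sub (hΨ _ hk t ht)

/-- A continuous function that exceeds each of its values immediately to the right is strictly
increasing. -/
theorem lt_of_eventually_right_lt {V : ℝ → ℝ} {a b : ℝ} (hab : a < b)
    (hV : ContinuousOn V (Icc a b)) (hloc : ∀ t ∈ Icc a b, ∀ᶠ s in 𝓝[>] t, V t < V s) :
    V a < V b := by
  have hle : ∀ a' ∈ Icc a b, V a' ≤ V b := fun a' ha' => by
    have hclosed : IsClosed ({s | V a' ≤ V s} ∩ Icc a' b) := by
      rw [inter_comm]
      exact (hV.mono (Icc_subset_Icc_left ha'.1)).preimage_isClosed_of_isClosed isClosed_Icc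
        isClosed_Ici
    refine hclosed.Icc_subset_of_forall_exists_gt (le_refl (V a')) ?_ (right_mem_Icc.2 ha'.2)
    rintro x ⟨hx, hxI⟩ y hy
    obtain ⟨z, hz, hzI⟩ := ((hloc x ⟨ha'.1.trans hxI.1, hxI.2.le⟩).and
      (Ioc_mem_nhdsGT hy)).exists
    exact ⟨z, le_trans hx hz.le, hzI⟩
  obtain ⟨z, hz, hzI⟩ := ((hloc a (left_mem_Icc.2 hab.le)).and (Ioc_mem_nhdsGT hab)).exists
  exact hz.trans_le (hle z ⟨hzI.1.le, hzI.2⟩)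

/-- Expansion of monotone phase-coupled oscillators (increasing coupling function):
the total-variation distance between any two distinct orbits in the open cone `C`
is strictly increasing. -/
theorem expansion_of_increasing_coupling
    (N : ℕ) (hN : 2 ≤ N) (Γ Γ' Γ'' : ℝ → ℝ)
    (hper : ∀ θ : ℝ, Γ (θ + 2 * π) = Γ θ)
    (hd1 : ∀ θ ∈ Ioo (0 : ℝ) (2 * π), HasDerivAt Γ (Γ' θ) θ)
    (hd2 : ∀ θ ∈ Ioo (0 : ℝ) (2 * π), HasDerivAt Γ' (Γ'' θ) θ)
    (hmono : ∀ θ ∈ Ioo (0 : ℝ) (2 * π), 0 < Γ' θ)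
    (hcurv : (∀ θ ∈ Ioo (0 : ℝ) (2 * π), 0 ≤ Γ'' θ) ∨
      (∀ θ ∈ Ioo (0 : ℝ) (2 * π), Γ'' θ ≤ 0))
    (I : Set ℝ) (hI : I.OrdConnected)
    (Θ Ψ : ℝ → ℕ → ℝ)
    (hΘ : IsSolFull N Γ I Θ) (hΨ : IsSolFull N Γ I Ψ)
    (hΘC : ∀ t ∈ I, inCone N (Θ t)) (hΨC : ∀ t ∈ I, inCone N (Ψ t))
    (hne : ∀ t ∈ I, ∃ k ∈ Finset.Icc 1 (N - 1), Θ t k ≠ Ψ t k) :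
    ∀ t₁ ∈ I, ∀ t₂ ∈ I, t₁ < t₂ →
      dist1 1 (N - 1) (Θ t₁) (Ψ t₁) < dist1 1 (N - 1) (Θ t₂) (Ψ t₂) := by
  intro t₁ ht₁ t₂ ht₂ hlt
  have hsub : Icc t₁ t₂ ⊆ I := hI.out ht₁ ht₂
  have hcont : ContinuousOn Γ' (Ioo 0 (2 * π)) := fun θ h =>
    (hd2 θ h).continuousAt.continuousWithinAt
  have hcurv' : MonotoneOn Γ' (Ioo 0 (2 * π)) ∨ AntitoneOn Γ' (Ioo 0 (2 * π)) := by
    have hdiff : DifferentiableOn ℝ Γ' (interior (Ioo 0 (2 * π))) := by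
      rw [interior_Ioo]
      exact fun θ h => (hd2 θ h).differentiableAt.differentiableWithinAt
    refine hcurv.imp (fun h => monotoneOn_of_deriv_nonneg (convex_Ioo _ _) hcont hdiff ?_)
      fun h => antitoneOn_of_deriv_nonpos (convex_Ioo _ _) hcont hdiff ?_
    all_goals
      rw [interior_Ioo]
      intro θ hθ
      rw [(hd2 θ hθ).deriv]
      exact h θ hθ
  have hderiv := fun t ht => hasDerivAt_quasiLift_sub hN hper hΘ hΨ (t := t) ht
  let δ : ℝ → ℕ → ℝ := fun t k => quasiLift N (Θ t) k - quasiLift N (Ψ t) k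
  have hdist : ∀ t, dist1 1 (N - 1) (Θ t) (Ψ t) =
      ∑ k ∈ Finset.range N, |δ t (k + 1) - δ t k| := fun t => dist1_eq_sum_quasiLift hN _ _
  simp only [hdist]
  refine lt_of_eventually_right_lt (V := fun t => ∑ k ∈ Finset.range N, |δ t (k + 1) - δ t k|)
    hlt ?_ fun t ht => ?_
  · refine continuousOn_finsetSum _ fun k _ t ht => ?_
    have hc := fun k => (hderiv t (hsub ht) k).continuousAt
    exact ((hc (k + 1)).sub (hc k)).abs.continuousWithinAt
  have htI := hsub ht
  let σ : ℕ → ℝ := fun k => if 0 ≤ δ t (k + 1) - δ t k then 1 else -1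
  have hσ : ∀ k, |σ k| = 1 := fun k => by
    simp only [σ]; split_ifs <;> simp
  have hσδ : ∀ k, σ k * (δ t (k + 1) - δ t k) = |δ t (k + 1) - δ t k| := fun k => by
    simp only [σ]
    split_ifs with h
    · rw [one_mul, abs_of_nonneg h]
    · rw [neg_one_mul, abs_of_neg (not_le.1 h)]
  have hσN : Function.Periodic σ N := fun k => by
    have hδ : ∀ k, δ t (k + N) = δ t k := fun k => by
      simp only [δ, quasiLift_add (by lia : 0 < N)]; ring
    simp only [σ, show k + N + 1 = k + 1 + N by ring, hδ]
  have hpos : 0 < ∑ k ∈ Finset.range N, |δ t (k + 1) - δ t k| := by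
    refine (Finset.sum_nonneg fun k _ => abs_nonneg _).lt_of_ne fun h0 => ?_
    obtain ⟨k, hk, hkne⟩ := hne t htI
    have hk := Finset.mem_Icc.1 hk
    have h1 := abs_sub_le_sum_abs (δ t) k
    have h2 := h1.trans (Finset.sum_le_sum_of_subset_of_nonneg
      (Finset.range_mono (show k ≤ N by lia)) fun i _ _ => abs_nonneg _)
    rw [← h0, abs_nonpos_iff] at h2
    simp only [δ, quasiLift_zero, quasiLift_of_mem (show 0 < k by lia) (show k < N by lia),
      sub_zero] at h2
    exact hkne (sub_eq_zero.1 h2)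
  have hg : HasDerivAt (fun s => ∑ k ∈ Finset.range N, σ k * (δ s (k + 1) - δ s k)) _ t :=
    HasDerivAt.fun_sum fun k _ =>
      ((hderiv t htI (k + 1)).sub (hderiv t htI k)).const_mul (σ k)
  have hg_pos := sum_sign_mul_velocityDiff_pos hN hper hd1 hcont hmono hcurv'
    (quasiLift_strictMono hN (hΘC t htI)) (quasiLift_strictMono hN (hΨC t htI))
    (quasiLift_add (by lia) _) (quasiLift_add (by lia) _) (fun k => (hσ k).le) hσN hσδ hpos
  simp only [sub_sub_sub_cancel_right] at hg
  have hev := (hasDerivAt_iff_tendsto_slope.1 hg).eventually (lt_mem_nhds hg_pos)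
  filter_upwards [hev.filter_mono (nhdsWithin_mono t fun s hs => ne_of_gt hs),
    self_mem_nhdsWithin] with s hs hts
  have hlt := (slope_pos_iff_of_le (le_of_lt hts)).1 hs
  calc ∑ k ∈ Finset.range N, |δ t (k + 1) - δ t k|
      = ∑ k ∈ Finset.range N, σ k * (δ t (k + 1) - δ t k) :=
        Finset.sum_congr rfl fun k _ => (hσδ k).symm
    _ < ∑ k ∈ Finset.range N, σ k * (δ s (k + 1) - δ s k) := hlt
    _ ≤ ∑ k ∈ Finset.range N, |δ s (k + 1) - δ s k| := Finset.sum_le_sum fun k _ => by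
        refine (le_abs_self _).trans ?_
        rw [abs_mul, hσ, one_mul]
end
end

section
/- Let N ≥ 3 and let Γ : ℝ → ℝ be 2π-periodic, twice differentiable on (0, 2π), with Γ′(θ) < 0 for every θ ∈ (0, 2π), and with second derivative of constant sign on (0, 2π). Let I ⊆ ℝ be an interval and let Θ, Ψ : I → ℝ^{N−2} be solutions of the reduced C′₁ dynamics on I such that Θ(t) ∈ C′₁, Ψ(t) ∈ C′₁ and Θ(t) ≠ Ψ(t) for every t ∈ I. Then the function t ↦ ‖Θ(t) − Ψ(t)‖_{(1)} is strictly decreasing on I. -/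
open Real Filter Set Topology

noncomputable section

/-- Right-hand side of the reduced `C′₁` dynamics (variables `θ̃_2,…,θ̃_{N-1}`):
`2Γ(x_k) + Σ_{j=2,j≠k}^{N-1} Γ(x_k - x_j) - Σ_{j=2}^{N-1} Γ(-x_j) - Γ(0)`. -/
def redRHS1 (N : ℕ) (Γ : ℝ → ℝ) (x : ℕ → ℝ) (k : ℕ) : ℝ :=
  2 * Γ (x k) + ∑ j ∈ (Finset.Icc 2 (N - 1)).erase k, Γ (x k - x j)
    - ∑ j ∈ Finset.Icc 2 (N - 1), Γ (-(x j)) - Γ 0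

/-- `Θ` is a solution of the reduced `C′₁` dynamics on `I`. -/
def IsSolRed1 (N : ℕ) (Γ : ℝ → ℝ) (I : Set ℝ) (Θ : ℝ → ℕ → ℝ) : Prop :=
  ∀ k ∈ Finset.Icc 2 (N - 1), ∀ t ∈ I,
    HasDerivAt (fun s => Θ s k) (redRHS1 N Γ (Θ t) k) t

/-- The open cone `C′₁ = {0 < x₂ < … < x_{N-1} < 2π}`. -/
def inConeRed1 (N : ℕ) (x : ℕ → ℝ) : Prop :=
  0 < x 2 ∧ (∀ k ∈ Finset.Icc 2 (N - 2), x k < x (k + 1)) ∧ x (N - 1) < 2 * π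

lemma ConvexOn.sub_le_sub_of_antitoneOn {f : ℝ → ℝ} {S : Set ℝ} (hf : ConvexOn ℝ S f)
    (hm : AntitoneOn f S) {a a' b b' : ℝ} (ha : a ∈ S) (ha' : a' ∈ S) (hb : b ∈ S) (hb' : b' ∈ S)
    (haa : a < a') (hbb : b < b') (hab' : a' < b') (hle : b' - a' ≤ b - a) :
    f a' - f b' ≤ f a - f b := by
  have hab : a < b := by linarith
  have h1 := hf.secant_mono ha hb hb' hab.ne' (by linarith) hbb.le
  have h2 := hf.secant_mono hb' ha ha' (by linarith) (by linarith) haa.le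
  have h3 : (f b - f a) / (b - a) ≤ (f b' - f a') / (b' - a') := by
    calc (f b - f a) / (b - a) ≤ (f b' - f a) / (b' - a) := h1
      _ = (f a - f b') / (a - b') := by rw [← neg_sub (f a), ← neg_sub a, neg_div_neg_eq]
      _ ≤ (f a' - f b') / (a' - b') := h2
      _ = (f b' - f a') / (b' - a') := by rw [← neg_sub (f a'), ← neg_sub a', neg_div_neg_eq]
  have h4 : f b' ≤ f a' := hm ha' hb' hab'.le
  have hp : 0 < b - a := by linarith
  have hp' : 0 < b' - a' := by linarith
  rw [div_le_div_iff₀ hp hp'] at h3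
  have h5 : (f a' - f b') * (b - a) ≤ (f a - f b) * (b - a) := by
    have h6 : (f a - f b) * (b' - a') ≤ (f a - f b) * (b - a) :=
      mul_le_mul_of_nonneg_left hle (sub_nonneg.2 (hm ha hb hab.le))
    linarith
  exact le_of_mul_le_mul_right h5 hp

lemma ConvexOn.sign_mul_sub_le {f : ℝ → ℝ} {S : Set ℝ} (hf : ConvexOn ℝ S f)
    (hm : AntitoneOn f S) {a a' b b' s : ℝ} (ha : a ∈ S) (ha' : a' ∈ S) (hb : b ∈ S) (hb' : b' ∈ S)
    (haa : a < a') (hbb : b < b') (hs : s = 1 ∨ s = -1)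
    (hse : 0 ≤ s * ((a' - b') - (a - b))) :
    s * ((f a' - f b') - (f a - f b)) ≤ |f a - f b| - |f a' - f b'| := by
  have key : ∀ {a a' b b' : ℝ}, a ∈ S → a' ∈ S → b ∈ S → b' ∈ S → a < a' → b < b' →
      0 ≤ (a' - b') - (a - b) →
      (f a' - f b') - (f a - f b) ≤ |f a - f b| - |f a' - f b'| := by
    intro a a' b b' ha ha' hb hb' haa hbb h
    rcases le_or_gt b' a' with hba | hba
    · rw [abs_of_nonpos (sub_nonpos.2 (hm hb' ha' hba))]
      linarith [neg_abs_le (f a - f b)]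
    · have h1 := hf.sub_le_sub_of_antitoneOn hm ha ha' hb hb' haa hbb hba (by linarith)
      rw [abs_of_nonneg (sub_nonneg.2 (hm ha' hb' hba.le)),
        abs_of_nonneg (sub_nonneg.2 (hm ha hb (by linarith)))]
      linarith
  rcases hs with rfl | rfl
  · rw [one_mul] at hse ⊢
    exact key ha ha' hb hb' haa hbb hse
  · have := key hb hb' ha ha' hbb haa (by linarith)
    rw [abs_sub_comm (f a), abs_sub_comm (f a')]
    linarith

lemma ConcaveOn.sign_mul_sub_le {f : ℝ → ℝ} {S : Set ℝ} (hf : ConcaveOn ℝ S f)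
    (hm : AntitoneOn f S) {a a' b b' s : ℝ} (ha : a ∈ S) (ha' : a' ∈ S) (hb : b ∈ S) (hb' : b' ∈ S)
    (haa : a < a') (hbb : b < b') (hs : s = 1 ∨ s = -1)
    (hse : 0 ≤ s * ((a' - b') - (a - b))) :
    s * ((f a' - f b') - (f a - f b)) ≤ |f a' - f b'| - |f a - f b| := by
  have hg : ConvexOn ℝ (Neg.neg ⁻¹' S) fun x => -f (-x) := by
    have := hf.neg.comp_linearMap (-LinearMap.id : ℝ →ₗ[ℝ] ℝ)
    exact this
  have hgm : AntitoneOn (fun x => -f (-x)) (Neg.neg ⁻¹' S) := by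
    intro x hx y hy hxy
    exact neg_le_neg (hm hy hx (neg_le_neg hxy))
  have := hg.sign_mul_sub_le hgm (a := -a') (a' := -a) (b := -b') (b' := -b) (s := s)
    (by simpa using ha') (by simpa using ha) (by simpa using hb') (by simpa using hb)
    (by linarith) (by linarith) hs (by linarith)
  simp only [neg_neg] at this
  rw [show -f a' - -f b' = -(f a' - f b') by ring, show -f a - -f b = -(f a - f b) by ring,
    abs_neg, abs_neg] at this
  linarith

lemma StrictAntiOn.sign_mul_sub_eq {f : ℝ → ℝ} {S : Set ℝ} (hm : StrictAntiOn f S)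
    {a b s : ℝ} (ha : a ∈ S) (hb : b ∈ S) (hs : s = 1 ∨ s = -1) (hse : 0 ≤ s * (a - b)) :
    s * (f a - f b) = -|f a - f b| := by
  rcases hs with rfl | rfl
  · rw [abs_of_nonpos (sub_nonpos.2 (hm.antitoneOn hb ha (by linarith)))]; ring
  · rw [abs_of_nonneg (sub_nonneg.2 (hm.antitoneOn ha hb (by linarith)))]; ring

lemma HasDerivAt.exists_sign_hasDerivWithinAt_abs {f : ℝ → ℝ} {f' t : ℝ}
    (hf : HasDerivAt f f' t) :
    ∃ s : ℝ, (s = 1 ∨ s = -1) ∧ 0 ≤ s * f t ∧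
      HasDerivWithinAt (fun τ => |f τ|) (s * f') (Ioi t) t := by
  rcases lt_trichotomy (f t) 0 with h | h | h
  · refine ⟨-1, Or.inr rfl, by linarith, ?_⟩
    have hev : (fun τ => |f τ|) =ᶠ[𝓝 t] fun τ => -f τ :=
      (hf.continuousAt.eventually_lt continuousAt_const h).mono fun τ hτ => abs_of_neg hτ
    simpa using (hf.neg.congr_of_eventuallyEq hev).hasDerivWithinAt
  · obtain ⟨s, hs, hsf⟩ : ∃ s : ℝ, (s = 1 ∨ s = -1) ∧ s * f' = |f'| := by
      rcases abs_cases f' with h | h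
      · exact ⟨1, Or.inl rfl, by linarith⟩
      · exact ⟨-1, Or.inr rfl, by linarith⟩
    refine ⟨s, hs, by simp [h], ?_⟩
    rw [hsf, hasDerivWithinAt_iff_tendsto_slope' self_notMem_Ioi]
    have h1 := (hasDerivWithinAt_iff_tendsto_slope' self_notMem_Ioi).1
      (hf.hasDerivWithinAt (s := Ioi t))
    refine h1.abs.congr' ?_
    filter_upwards [self_mem_nhdsWithin] with τ hτ
    have hτ' : 0 < τ - t := sub_pos.2 hτ
    simp [slope_def_field, h, abs_div, abs_of_pos hτ']
  · refine ⟨1, Or.inl rfl, by linarith, ?_⟩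
    have hev : (fun τ => |f τ|) =ᶠ[𝓝 t] f :=
      (continuousAt_const.eventually_lt hf.continuousAt h).mono fun τ hτ => abs_of_pos hτ
    simpa using (hf.congr_of_eventuallyEq hev).hasDerivWithinAt

lemma lt_of_forall_hasDerivWithinAt_Ioi_neg {V : ℝ → ℝ} {a b : ℝ} (hab : a < b)
    (hc : ContinuousOn V (Icc a b))
    (hV : ∀ t ∈ Ico a b, ∃ v < 0, HasDerivWithinAt V v (Ioi t) t) : V b < V a := by
  have hdrop : ∀ t ∈ Ico a b, ∃ τ ∈ Icc a b, V τ < V t := by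
    intro t ht
    obtain ⟨v, hv, hd⟩ := hV t ht
    have h1 := (hasDerivWithinAt_iff_tendsto_slope' self_notMem_Ioi).1 hd
    have h2 : ∀ᶠ τ in 𝓝[>] t, τ ∈ Ioo t b := Ioo_mem_nhdsGT ht.2
    obtain ⟨τ, hτ, hmem⟩ := ((h1.eventually_lt_const hv).and h2).exists
    refine ⟨τ, ⟨ht.1.trans hmem.1.le, hmem.2.le⟩, ?_⟩
    rw [slope_def_field, div_lt_iff₀ (sub_pos.2 hmem.1)] at hτ
    linarith
  obtain ⟨m, hm, hmin⟩ := isCompact_Icc.exists_isMinOn (nonempty_Icc.2 hab.le) hc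
  have hmb : m = b := by
    by_contra hne
    obtain ⟨τ, hτ, hlt⟩ := hdrop m ⟨hm.1, lt_of_le_of_ne hm.2 hne⟩
    exact absurd (hmin hτ) (not_le.2 hlt)
  obtain ⟨τ, hτ, hlt⟩ := hdrop a ⟨le_rfl, hab⟩
  rw [← hmb]
  exact (hmin hτ).trans_lt hlt

/-- Difference of the couplings between sites `k` and `i` in two configurations. -/
def couplingDiff (Γ : ℝ → ℝ) (X Y : ℕ → ℝ) (i k : ℕ) : ℝ :=
  Γ (X k - X i) - Γ (Y k - Y i)

/-- An increasing configuration on the circle, cut open at the site `1`, which is repeated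
as the site `N`. -/
def IsCyclicConfig (N : ℕ) (X : ℕ → ℝ) : Prop :=
  StrictMonoOn X (Set.Icc 1 N) ∧ X 1 = 0 ∧ X N = 2 * π

namespace IsCyclicConfig

variable {N : ℕ} {X : ℕ → ℝ}

lemma sub_mem (hX : IsCyclicConfig N X) {i k : ℕ} (hi : 1 < i) (hik : i < k) (hk : k ≤ N) :
    X k - X i ∈ Ioo 0 (2 * π) := by
  obtain ⟨hm, h1, hN⟩ := hX
  have a := hm (a := 1) (b := i) ⟨le_rfl, by omega⟩ ⟨by omega, by omega⟩ hi
  have b := hm (a := i) (b := k) ⟨by omega, by omega⟩ ⟨by omega, by omega⟩ hik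
  have c := hm.monotoneOn (a := k) (b := N) ⟨by omega, by omega⟩ ⟨by omega, by omega⟩ hk
  constructor <;> linarith

lemma sub_add_mem (hX : IsCyclicConfig N X) {i k : ℕ} (hk : 1 ≤ k) (hik : k < i) (hi : i ≤ N)
    (hne : 1 < k ∨ i < N) :
    X k - X i + 2 * π ∈ Ioo 0 (2 * π) := by
  obtain ⟨hm, h1, hN⟩ := hX
  have b := hm (a := k) (b := i) ⟨by omega, by omega⟩ ⟨by omega, by omega⟩ hik
  have a := hm.monotoneOn (a := 1) (b := k) ⟨le_rfl, by omega⟩ ⟨by omega, by omega⟩ hk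
  have c := hm.monotoneOn (a := i) (b := N) ⟨by omega, by omega⟩ ⟨by omega, by omega⟩ hi
  rcases hne with h | h
  · have a := hm (a := 1) (b := k) ⟨le_rfl, by omega⟩ ⟨by omega, by omega⟩ h
    constructor <;> linarith
  · have c := hm (a := i) (b := N) ⟨by omega, by omega⟩ ⟨by omega, by omega⟩ h
    constructor <;> linarith

lemma lt_succ (hX : IsCyclicConfig N X) {j : ℕ} (hj : 1 ≤ j) (hjN : j < N) : X j < X (j + 1) :=
  hX.1 ⟨hj, hjN.le⟩ ⟨by omega, hjN⟩ (Nat.lt_succ_self j)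

end IsCyclicConfig

section Coupling

variable {N : ℕ} {Γ : ℝ → ℝ} {X Y : ℕ → ℝ} {i j : ℕ} {s : ℝ}

lemma couplingDiff_self (i : ℕ) : couplingDiff Γ X Y i i = 0 := by
  simp [couplingDiff]

lemma couplingDiff_shift (hper : ∀ θ : ℝ, Γ (θ + 2 * π) = Γ θ) (i k : ℕ) :
    couplingDiff Γ X Y i k = Γ (X k - X i + 2 * π) - Γ (Y k - Y i + 2 * π) := by
  rw [couplingDiff, hper, hper]

lemma couplingDiff_last_eq_first (hper : ∀ θ : ℝ, Γ (θ + 2 * π) = Γ θ)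
    (hX : IsCyclicConfig N X) (hY : IsCyclicConfig N Y) (i : ℕ) :
    couplingDiff Γ X Y i N = couplingDiff Γ X Y i 1 := by
  rw [couplingDiff_shift hper i 1, couplingDiff, hX.2.1, hX.2.2, hY.2.1, hY.2.2]
  ring_nf

lemma couplingDiff_last_first (hper : ∀ θ : ℝ, Γ (θ + 2 * π) = Γ θ)
    (hX : IsCyclicConfig N X) (hY : IsCyclicConfig N Y) : couplingDiff Γ X Y N 1 = 0 := by
  rw [← couplingDiff_last_eq_first hper hX hY, couplingDiff_self]

lemma sign_mul_couplingDiff_succ (hper : ∀ θ : ℝ, Γ (θ + 2 * π) = Γ θ)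
    (hm : StrictAntiOn Γ (Ioo 0 (2 * π))) (hN : 3 ≤ N)
    (hX : IsCyclicConfig N X) (hY : IsCyclicConfig N Y) (hj : 1 ≤ j) (hjN : j < N)
    (hij : i = j ∧ 1 < i ∨ i = N ∧ j = 1)
    (hs : s = 1 ∨ s = -1) (hse : 0 ≤ s * ((X (j + 1) - Y (j + 1)) - (X j - Y j))) :
    couplingDiff Γ X Y i j = 0 ∧
    s * couplingDiff Γ X Y i (j + 1) = -|couplingDiff Γ X Y i (j + 1)| ∧
    ((X (j + 1) - Y (j + 1)) - (X j - Y j) ≠ 0 → couplingDiff Γ X Y i (j + 1) ≠ 0) := by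
  rcases hij with ⟨rfl, hi⟩ | ⟨rfl, rfl⟩
  · have hx := hX.sub_mem hi (Nat.lt_succ_self i) hjN
    have hy := hY.sub_mem hi (Nat.lt_succ_self i) hjN
    refine ⟨couplingDiff_self i, hm.sign_mul_sub_eq hx hy hs (by convert hse using 2; ring), ?_⟩
    intro hne h0
    have := hm.injOn hx hy (sub_eq_zero.1 h0)
    exact hne (by linarith)
  · have hx := hX.sub_add_mem (k := 1 + 1) (i := i) (by omega) (by omega) le_rfl (by omega)
    have hy := hY.sub_add_mem (k := 1 + 1) (i := i) (by omega) (by omega) le_rfl (by omega)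
    refine ⟨couplingDiff_last_first hper hX hY, ?_, ?_⟩
    · rw [couplingDiff_shift hper]
      refine hm.sign_mul_sub_eq hx hy hs ?_
      rw [hX.2.1, hY.2.1] at hse
      rw [hX.2.2, hY.2.2]
      convert hse using 2; ring
    · rw [couplingDiff_shift hper]
      intro hne h0
      have := hm.injOn hx hy (sub_eq_zero.1 h0)
      rw [hX.2.2, hY.2.2] at this
      rw [hX.2.1, hY.2.1] at hne
      exact hne (by linarith)

lemma sign_mul_couplingDiff_pred (hper : ∀ θ : ℝ, Γ (θ + 2 * π) = Γ θ)
    (hm : StrictAntiOn Γ (Ioo 0 (2 * π))) (hN : 3 ≤ N)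
    (hX : IsCyclicConfig N X) (hY : IsCyclicConfig N Y) (hj : 1 ≤ j) (hjN : j < N)
    (hs : s = 1 ∨ s = -1) (hse : 0 ≤ s * ((X (j + 1) - Y (j + 1)) - (X j - Y j))) :
    s * couplingDiff Γ X Y (j + 1) j = |couplingDiff Γ X Y (j + 1) j| ∧
    ((X (j + 1) - Y (j + 1)) - (X j - Y j) ≠ 0 → couplingDiff Γ X Y (j + 1) j ≠ 0) := by
  have hx := hX.sub_add_mem hj (Nat.lt_succ_self j) hjN (by omega)
  have hy := hY.sub_add_mem hj (Nat.lt_succ_self j) hjN (by omega)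
  rw [couplingDiff_shift hper]
  constructor
  · have := hm.sign_mul_sub_eq hy hx hs (by convert hse using 2; ring)
    rw [abs_sub_comm] at this
    linarith
  · intro hne h0
    have := hm.injOn hx hy (sub_eq_zero.1 h0)
    exact hne (by linarith)

/-- Case analysis on the position of the edge `(j, j + 1)` relative to the reference site `i`:
it starts at `i`, ends at `i`, or all phase differences lie in `(0, 2π)` modulo `2π`. -/
lemma couplingDiff_cases (hper : ∀ θ : ℝ, Γ (θ + 2 * π) = Γ θ)
    (hX : IsCyclicConfig N X) (hY : IsCyclicConfig N Y) (hj : 1 ≤ j) (hjN : j < N)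
    (hi : 1 < i) (hiN : i ≤ N) (hse : 0 ≤ s * ((X (j + 1) - Y (j + 1)) - (X j - Y j)))
    {P : ℝ → ℝ → Prop}
    (hfirst : i = j ∧ 1 < i ∨ i = N ∧ j = 1 →
      P (couplingDiff Γ X Y i j) (couplingDiff Γ X Y i (j + 1)))
    (hlast : i = j + 1 → P (couplingDiff Γ X Y i j) (couplingDiff Γ X Y i (j + 1)))
    (hmid : ∀ a ∈ Ioo 0 (2 * π), ∀ a' ∈ Ioo 0 (2 * π), ∀ b ∈ Ioo 0 (2 * π),
      ∀ b' ∈ Ioo 0 (2 * π), a < a' → b < b' → 0 ≤ s * ((a' - b') - (a - b)) →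
      P (Γ a - Γ b) (Γ a' - Γ b')) :
    P (couplingDiff Γ X Y i j) (couplingDiff Γ X Y i (j + 1)) := by
  by_cases h1 : i = j ∧ 1 < i ∨ i = N ∧ j = 1
  · exact hfirst h1
  by_cases h2 : i = j + 1
  · exact hlast h2
  have hxj := hX.lt_succ hj hjN
  have hyj := hY.lt_succ hj hjN
  rcases lt_or_gt_of_ne (show i ≠ j by omega) with h | h
  · refine hmid _ (hX.sub_mem hi h hjN.le) _ (hX.sub_mem hi (h.trans (Nat.lt_succ_self j)) hjN) _
      (hY.sub_mem hi h hjN.le) _ (hY.sub_mem hi (h.trans (Nat.lt_succ_self j)) hjN)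
      (by linarith) (by linarith) ?_
    convert hse using 2; ring
  · rw [couplingDiff_shift hper, couplingDiff_shift hper]
    refine hmid _ (hX.sub_add_mem hj h hiN (by omega)) _
      (hX.sub_add_mem (by omega) (by omega) hiN (by omega)) _
      (hY.sub_add_mem hj h hiN (by omega)) _
      (hY.sub_add_mem (by omega) (by omega) hiN (by omega))
      (by linarith) (by linarith) ?_
    convert hse using 2; ring

lemma sum_sign_mul_neg_of_potential {D : ℕ → ℕ → ℝ} {σ m : ℕ → ℝ} {ε : ℝ} (hN : 1 ≤ N)
    (hD : ∀ i, D i N = D i 1) (hm : ∀ i, 0 < m i)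
    (hle : ∀ i ∈ Finset.Ioc 1 N, ∀ j ∈ Finset.Ico 1 N,
      σ j * (D i (j + 1) - D i j) ≤ ε * (|D i (j + 1)| - |D i j|))
    (hlt : ∃ i ∈ Finset.Ioc 1 N, ∃ j ∈ Finset.Ico 1 N,
      σ j * (D i (j + 1) - D i j) < ε * (|D i (j + 1)| - |D i j|)) :
    ∑ j ∈ Finset.Ico 1 N, σ j * ∑ i ∈ Finset.Ioc 1 N, m i * (D i (j + 1) - D i j) < 0 := by
  have hswap : ∑ j ∈ Finset.Ico 1 N, σ j * ∑ i ∈ Finset.Ioc 1 N, m i * (D i (j + 1) - D i j)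
      = ∑ i ∈ Finset.Ioc 1 N, m i * ∑ j ∈ Finset.Ico 1 N, σ j * (D i (j + 1) - D i j) := by
    simp_rw [Finset.mul_sum]
    rw [Finset.sum_comm]
    refine Finset.sum_congr rfl fun i _ => Finset.sum_congr rfl fun j _ => by ring
  have htel : ∀ i, ∑ j ∈ Finset.Ico 1 N, ε * (|D i (j + 1)| - |D i j|) = 0 := by
    intro i
    rw [← Finset.mul_sum, Finset.sum_Ico_sub (fun j => |D i j|) hN, hD, sub_self, mul_zero]
  rw [hswap]
  obtain ⟨i, hi, j, hj, hij⟩ := hlt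
  refine Finset.sum_neg' (fun i hi => ?_) ⟨i, hi, ?_⟩
  · exact mul_nonpos_of_nonneg_of_nonpos (hm i).le
      ((Finset.sum_le_sum (hle i hi)).trans_eq (htel i))
  · exact mul_neg_of_pos_of_neg (hm i)
      ((Finset.sum_lt_sum (hle i hi) ⟨j, hj, hij⟩).trans_eq (htel i))

lemma sum_sign_mul_couplingDiff_neg (hper : ∀ θ : ℝ, Γ (θ + 2 * π) = Γ θ)
    (hm : StrictAntiOn Γ (Ioo 0 (2 * π)))
    (hcurv : ConvexOn ℝ (Ioo 0 (2 * π)) Γ ∨ ConcaveOn ℝ (Ioo 0 (2 * π)) Γ) (hN : 3 ≤ N)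
    (hX : IsCyclicConfig N X) (hY : IsCyclicConfig N Y) {σ w : ℕ → ℝ} (hw : ∀ i, 0 < w i)
    (hσ : ∀ j ∈ Finset.Ico 1 N, (σ j = 1 ∨ σ j = -1) ∧
      0 ≤ σ j * ((X (j + 1) - Y (j + 1)) - (X j - Y j)))
    (hne : ∃ j ∈ Finset.Ico 1 N, (X (j + 1) - Y (j + 1)) - (X j - Y j) ≠ 0) :
    ∑ j ∈ Finset.Ico 1 N, σ j * ∑ i ∈ Finset.Ioc 1 N,
      w i * (couplingDiff Γ X Y i (j + 1) - couplingDiff Γ X Y i j) < 0 := by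
  obtain ⟨j₀, hj₀, hne⟩ := hne
  have hj₀' := Finset.mem_Ico.1 hj₀
  obtain ⟨hσ₀, hσe₀⟩ := hσ j₀ hj₀
  rcases hcurv with hc | hc
  · refine sum_sign_mul_neg_of_potential (ε := -1) (by omega)
      (couplingDiff_last_eq_first hper hX hY) hw ?_
      ⟨j₀ + 1, Finset.mem_Ioc.2 (by omega), j₀, hj₀, ?_⟩
    · intro i hi j hj
      obtain ⟨hs, hse⟩ := hσ j hj
      rw [Finset.mem_Ico] at hj
      rw [Finset.mem_Ioc] at hi
      refine couplingDiff_cases (P := fun p q => σ j * (q - p) ≤ -1 * (|q| - |p|))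
        hper hX hY hj.1 hj.2 hi.1 hi.2 hse ?_ ?_ ?_
      · intro hij
        obtain ⟨h0, h1, -⟩ := sign_mul_couplingDiff_succ hper hm hN hX hY hj.1 hj.2 hij hs hse
        rw [h0, sub_zero, h1]; simp
      · rintro rfl
        obtain ⟨h1, -⟩ := sign_mul_couplingDiff_pred hper hm hN hX hY hj.1 hj.2 hs hse
        rw [couplingDiff_self, zero_sub, mul_neg, h1, abs_zero]
        linarith [abs_nonneg (couplingDiff Γ X Y (j + 1) j)]
      · intro a ha a' ha' b hb b' hb' haa hbb h
        have := hc.sign_mul_sub_le hm.antitoneOn ha ha' hb hb' haa hbb hs h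
        linarith
    · obtain ⟨h1, h2⟩ := sign_mul_couplingDiff_pred hper hm hN hX hY hj₀'.1 hj₀'.2 hσ₀ hσe₀
      rw [couplingDiff_self, zero_sub, mul_neg, h1, abs_zero]
      linarith [abs_pos.2 (h2 hne)]
  · obtain ⟨i₀, hi₀, hij₀⟩ : ∃ i ∈ Finset.Ioc 1 N, i = j₀ ∧ 1 < i ∨ i = N ∧ j₀ = 1 := by
      rcases Nat.eq_or_lt_of_le hj₀'.1 with h | h
      · exact ⟨N, Finset.mem_Ioc.2 (by omega), Or.inr ⟨rfl, h.symm⟩⟩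
      · exact ⟨j₀, Finset.mem_Ioc.2 (by omega), Or.inl ⟨rfl, h⟩⟩
    refine sum_sign_mul_neg_of_potential (ε := 1) (by omega)
      (couplingDiff_last_eq_first hper hX hY) hw ?_ ⟨i₀, hi₀, j₀, hj₀, ?_⟩
    · intro i hi j hj
      obtain ⟨hs, hse⟩ := hσ j hj
      rw [Finset.mem_Ico] at hj
      rw [Finset.mem_Ioc] at hi
      refine couplingDiff_cases (P := fun p q => σ j * (q - p) ≤ 1 * (|q| - |p|))
        hper hX hY hj.1 hj.2 hi.1 hi.2 hse ?_ ?_ ?_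
      · intro hij
        obtain ⟨h0, h1, -⟩ := sign_mul_couplingDiff_succ hper hm hN hX hY hj.1 hj.2 hij hs hse
        rw [h0, sub_zero, h1, abs_zero]
        linarith [abs_nonneg (couplingDiff Γ X Y i (j + 1))]
      · rintro rfl
        obtain ⟨h1, -⟩ := sign_mul_couplingDiff_pred hper hm hN hX hY hj.1 hj.2 hs hse
        rw [couplingDiff_self, zero_sub, mul_neg, h1, abs_zero]
        linarith
      · intro a ha a' ha' b hb b' hb' haa hbb h
        have := hc.sign_mul_sub_le hm.antitoneOn ha ha' hb hb' haa hbb hs h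
        linarith
    · obtain ⟨h0, h1, h2⟩ :=
        sign_mul_couplingDiff_succ hper hm hN hX hY hj₀'.1 hj₀'.2 hij₀ hσ₀ hσe₀
      rw [h0, sub_zero, h1, abs_zero]
      linarith [abs_pos.2 (h2 hne)]

end Coupling

/-- The configuration `x` completed by the site `1` at phase `0` and the site `N` at `2π`. -/
def cyclicExt (N : ℕ) (x : ℕ → ℝ) (k : ℕ) : ℝ :=
  if k ≤ 1 then 0 else if N ≤ k then 2 * π else x k

section CyclicExt

variable {N k : ℕ} {x y : ℕ → ℝ}

lemma cyclicExt_one : cyclicExt N x 1 = 0 := by simp [cyclicExt]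

lemma cyclicExt_last (hN : 3 ≤ N) : cyclicExt N x N = 2 * π := by
  simp [cyclicExt, show ¬ N ≤ 1 by omega]

lemma cyclicExt_of_mem (hk : k ∈ Finset.Icc 2 (N - 1)) : cyclicExt N x k = x k := by
  rw [Finset.mem_Icc] at hk
  simp [cyclicExt, show ¬ k ≤ 1 by omega, show ¬ N ≤ k by omega]

lemma isCyclicConfig_cyclicExt (hN : 3 ≤ N) (hx : inConeRed1 N x) :
    IsCyclicConfig N (cyclicExt N x) := by
  refine ⟨strictMonoOn_of_lt_add_one ordConnected_Icc ?_, cyclicExt_one, cyclicExt_last hN⟩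
  intro j _ hj hj'
  obtain ⟨h2, hmid, hlast⟩ := hx
  have hj1 := hj.1
  have hj2 := hj'.2
  by_cases h : j = 1
  · subst h
    rw [cyclicExt_one, cyclicExt_of_mem (Finset.mem_Icc.2 (by omega))]
    exact h2
  by_cases h' : j + 1 = N
  · rw [h', cyclicExt_last hN, cyclicExt_of_mem (Finset.mem_Icc.2 (by omega))]
    rwa [show j = N - 1 by omega]
  · rw [cyclicExt_of_mem (Finset.mem_Icc.2 (by omega)),
      cyclicExt_of_mem (Finset.mem_Icc.2 (by omega))]
    exact hmid j (Finset.mem_Icc.2 (by omega))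

lemma dist1_eq_sum_cyclicExt (hN : 3 ≤ N) :
    dist1 2 (N - 1) x y = ∑ j ∈ Finset.Ico 1 N,
      |(cyclicExt N x (j + 1) - cyclicExt N y (j + 1)) - (cyclicExt N x j - cyclicExt N y j)| := by
  obtain ⟨n, rfl⟩ : ∃ n, N = n + 3 := ⟨N - 3, by omega⟩
  rw [Finset.sum_Ico_succ_top (by omega), Finset.sum_eq_sum_Ico_succ_bot (by omega), dist1]
  congr 1
  · congr 1
    · rw [cyclicExt_one, cyclicExt_one, cyclicExt_of_mem (Finset.mem_Icc.2 (by omega)),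
        cyclicExt_of_mem (Finset.mem_Icc.2 (by omega))]
      simp
    · refine Finset.sum_congr (by ext; simp; omega) fun j hj => ?_
      rw [Finset.mem_Ico] at hj
      rw [cyclicExt_of_mem (Finset.mem_Icc.2 (by omega)),
        cyclicExt_of_mem (Finset.mem_Icc.2 (by omega)),
        cyclicExt_of_mem (Finset.mem_Icc.2 (by omega)),
        cyclicExt_of_mem (Finset.mem_Icc.2 (by omega))]
  · rw [cyclicExt_last hN, cyclicExt_last hN, cyclicExt_of_mem (Finset.mem_Icc.2 (by omega)),
      cyclicExt_of_mem (Finset.mem_Icc.2 (by omega)), sub_self, zero_sub, abs_neg]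
    rfl

lemma exists_edge_ne (hne : ∃ k ∈ Finset.Icc 2 (N - 1), x k ≠ y k) :
    ∃ j ∈ Finset.Ico 1 N, (cyclicExt N x (j + 1) - cyclicExt N y (j + 1))
      - (cyclicExt N x j - cyclicExt N y j) ≠ 0 := by
  by_contra! hall
  obtain ⟨k, hk, hk'⟩ := hne
  have hzero : ∀ k, 1 ≤ k → k ≤ N → cyclicExt N x k - cyclicExt N y k = 0 := by
    intro k hk
    induction k, hk using Nat.le_induction with
    | base => intro _; rw [cyclicExt_one, cyclicExt_one, sub_self]
    | succ k hk ih =>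
      intro hkN
      have := hall k (Finset.mem_Ico.2 (by omega))
      linarith [ih (by omega)]
  have hkm := Finset.mem_Icc.1 hk
  have := hzero k (by omega) (by omega)
  rw [cyclicExt_of_mem hk, cyclicExt_of_mem hk] at this
  exact hk' (sub_eq_zero.1 this)

variable {Γ : ℝ → ℝ}

lemma redRHS1_sub_eq (hper : ∀ θ : ℝ, Γ (θ + 2 * π) = Γ θ) (hN : 3 ≤ N)
    (hk : k ∈ Finset.Icc 2 (N - 1)) :
    redRHS1 N Γ x k - redRHS1 N Γ y k =
      ∑ i ∈ Finset.Ioc 1 N, (if i = N then 2 else 1) *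
        (couplingDiff Γ (cyclicExt N x) (cyclicExt N y) i k
          - couplingDiff Γ (cyclicExt N x) (cyclicExt N y) i 1) := by
  have hset : Finset.Ioc 1 N = insert N (Finset.Icc 2 (N - 1)) := by
    ext i; simp only [Finset.mem_Ioc, Finset.mem_insert, Finset.mem_Icc]; omega
  have hnot : N ∉ Finset.Icc 2 (N - 1) := by simp only [Finset.mem_Icc]; omega
  have hpi (z : ℝ) : Γ (z - 2 * π) = Γ z := by rw [← hper, sub_add_cancel]
  have hterm : ∀ i ∈ Finset.Icc 2 (N - 1), (if i = N then (2 : ℝ) else 1) *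
        (couplingDiff Γ (cyclicExt N x) (cyclicExt N y) i k
          - couplingDiff Γ (cyclicExt N x) (cyclicExt N y) i 1) =
      ((Γ (x k - x i) - Γ (y k - y i)) - (Γ (-(x i)) - Γ (-(y i)))) := by
    intro i hi
    rw [if_neg (by rintro rfl; exact hnot hi), couplingDiff, couplingDiff, cyclicExt_one,
      cyclicExt_one, cyclicExt_of_mem hi, cyclicExt_of_mem hi, cyclicExt_of_mem hk,
      cyclicExt_of_mem hk]
    simp
  rw [hset, Finset.sum_insert hnot, Finset.sum_congr rfl hterm, if_pos rfl, couplingDiff,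
    couplingDiff, cyclicExt_one, cyclicExt_one, cyclicExt_last hN, cyclicExt_last hN,
    cyclicExt_of_mem hk, cyclicExt_of_mem hk, hpi, hpi, sub_self, redRHS1, redRHS1]
  simp only [Finset.sum_sub_distrib]
  rw [← Finset.add_sum_erase _ (fun i => Γ (x k - x i)) hk,
    ← Finset.add_sum_erase _ (fun i => Γ (y k - y i)) hk, sub_self, sub_self]
  ring

lemma hasDerivAt_cyclicExt_sub (hper : ∀ θ : ℝ, Γ (θ + 2 * π) = Γ θ) (hN : 3 ≤ N)
    {I : Set ℝ} {Θ Ψ : ℝ → ℕ → ℝ} (hΘ : IsSolRed1 N Γ I Θ) (hΨ : IsSolRed1 N Γ I Ψ)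
    {t : ℝ} (ht : t ∈ I) (hX : IsCyclicConfig N (cyclicExt N (Θ t)))
    (hY : IsCyclicConfig N (cyclicExt N (Ψ t))) (hk : 1 ≤ k) (hkN : k ≤ N) :
    HasDerivAt (fun τ => cyclicExt N (Θ τ) k - cyclicExt N (Ψ τ) k)
      (∑ i ∈ Finset.Ioc 1 N, (if i = N then 2 else 1) *
        (couplingDiff Γ (cyclicExt N (Θ t)) (cyclicExt N (Ψ t)) i k
          - couplingDiff Γ (cyclicExt N (Θ t)) (cyclicExt N (Ψ t)) i 1)) t := by
  by_cases h1 : k = 1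
  · subst h1
    simpa [cyclicExt_one] using hasDerivAt_const t (0 : ℝ)
  by_cases h2 : k = N
  · subst h2
    simpa [cyclicExt_last hN, couplingDiff_last_eq_first hper hX hY]
      using hasDerivAt_const t (0 : ℝ)
  have hk' : k ∈ Finset.Icc 2 (N - 1) := Finset.mem_Icc.2 (by omega)
  simp only [cyclicExt_of_mem hk']
  rw [← redRHS1_sub_eq hper hN hk']
  exact (hΘ k hk' t ht).sub (hΨ k hk' t ht)

end CyclicExt

/-- Contraction of the reduced `C′₁` dynamics for a decreasing coupling function. -/
theorem contraction_reducedC1_of_decreasing_coupling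
    (N : ℕ) (hN : 3 ≤ N) (Γ Γ' Γ'' : ℝ → ℝ)
    (hper : ∀ θ : ℝ, Γ (θ + 2 * π) = Γ θ)
    (hd1 : ∀ θ ∈ Ioo (0 : ℝ) (2 * π), HasDerivAt Γ (Γ' θ) θ)
    (hd2 : ∀ θ ∈ Ioo (0 : ℝ) (2 * π), HasDerivAt Γ' (Γ'' θ) θ)
    (hmono : ∀ θ ∈ Ioo (0 : ℝ) (2 * π), Γ' θ < 0)
    (hcurv : (∀ θ ∈ Ioo (0 : ℝ) (2 * π), 0 ≤ Γ'' θ) ∨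
      (∀ θ ∈ Ioo (0 : ℝ) (2 * π), Γ'' θ ≤ 0))
    (I : Set ℝ) (hI : I.OrdConnected)
    (Θ Ψ : ℝ → ℕ → ℝ)
    (hΘ : IsSolRed1 N Γ I Θ) (hΨ : IsSolRed1 N Γ I Ψ)
    (hΘC : ∀ t ∈ I, inConeRed1 N (Θ t)) (hΨC : ∀ t ∈ I, inConeRed1 N (Ψ t))
    (hne : ∀ t ∈ I, ∃ k ∈ Finset.Icc 2 (N - 1), Θ t k ≠ Ψ t k) :
    ∀ t₁ ∈ I, ∀ t₂ ∈ I, t₁ < t₂ →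
      dist1 2 (N - 1) (Θ t₂) (Ψ t₂) < dist1 2 (N - 1) (Θ t₁) (Ψ t₁) := by
  have hstrict : StrictAntiOn Γ (Ioo 0 (2 * π)) :=
    strictAntiOn_of_hasDerivWithinAt_neg (f' := Γ') (convex_Ioo _ _)
      (fun θ hθ => (hd1 θ hθ).continuousAt.continuousWithinAt)
      (fun θ hθ => (hd1 θ (interior_subset hθ)).hasDerivWithinAt)
      (fun θ hθ => hmono θ (interior_subset hθ))
  have hcurv' : ConvexOn ℝ (Ioo 0 (2 * π)) Γ ∨ ConcaveOn ℝ (Ioo 0 (2 * π)) Γ := by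
    refine hcurv.imp (fun h => ?_) (fun h => ?_)
    · exact convexOn_of_hasDerivWithinAt2_nonneg (f' := Γ') (f'' := Γ'') (convex_Ioo _ _)
        (fun θ hθ => (hd1 θ hθ).continuousAt.continuousWithinAt)
        (fun θ hθ => (hd1 θ (interior_subset hθ)).hasDerivWithinAt)
        (fun θ hθ => (hd2 θ (interior_subset hθ)).hasDerivWithinAt)
        (fun θ hθ => h θ (interior_subset hθ))
    · exact concaveOn_of_hasDerivWithinAt2_nonpos (f' := Γ') (f'' := Γ'') (convex_Ioo _ _)
        (fun θ hθ => (hd1 θ hθ).continuousAt.continuousWithinAt)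
        (fun θ hθ => (hd1 θ (interior_subset hθ)).hasDerivWithinAt)
        (fun θ hθ => (hd2 θ (interior_subset hθ)).hasDerivWithinAt)
        (fun θ hθ => h θ (interior_subset hθ))
  intro t₁ ht₁ t₂ ht₂ hlt
  have hsub : Icc t₁ t₂ ⊆ I := hI.out ht₁ ht₂
  have hedge : ∀ t ∈ I, ∀ j ∈ Finset.Ico 1 N, HasDerivAt
      (fun τ => (cyclicExt N (Θ τ) (j + 1) - cyclicExt N (Ψ τ) (j + 1))
        - (cyclicExt N (Θ τ) j - cyclicExt N (Ψ τ) j))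
      (∑ i ∈ Finset.Ioc 1 N, (if i = N then 2 else 1) *
        (couplingDiff Γ (cyclicExt N (Θ t)) (cyclicExt N (Ψ t)) i (j + 1)
          - couplingDiff Γ (cyclicExt N (Θ t)) (cyclicExt N (Ψ t)) i j)) t := by
    intro t ht j hj
    rw [Finset.mem_Ico] at hj
    have hX := isCyclicConfig_cyclicExt hN (hΘC t ht)
    have hY := isCyclicConfig_cyclicExt hN (hΨC t ht)
    refine ((hasDerivAt_cyclicExt_sub hper hN hΘ hΨ ht hX hY (k := j + 1) (by omega) hj.2).sub
      (hasDerivAt_cyclicExt_sub hper hN hΘ hΨ ht hX hY (k := j) hj.1 hj.2.le)).congr_deriv ?_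
    rw [← Finset.sum_sub_distrib]
    exact Finset.sum_congr rfl fun i _ => by ring
  simp only [dist1_eq_sum_cyclicExt hN]
  refine lt_of_forall_hasDerivWithinAt_Ioi_neg (V := fun τ => ∑ j ∈ Finset.Ico 1 N,
    |(cyclicExt N (Θ τ) (j + 1) - cyclicExt N (Ψ τ) (j + 1))
      - (cyclicExt N (Θ τ) j - cyclicExt N (Ψ τ) j)|) hlt ?_ ?_
  · exact continuousOn_finsetSum _ fun j hj t ht =>
      (hedge t (hsub ht) j hj).continuousAt.abs.continuousWithinAt
  · intro t ht
    have htI := hsub (Ico_subset_Icc_self ht)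
    have hsign := fun j hj => (hedge t htI j hj).exists_sign_hasDerivWithinAt_abs
    choose! σ hσ using hsign
    refine ⟨_, ?_, HasDerivWithinAt.fun_sum fun j hj => (hσ j hj).2.2⟩
    exact sum_sign_mul_couplingDiff_neg hper hstrict hcurv' hN
      (isCyclicConfig_cyclicExt hN (hΘC t htI)) (isCyclicConfig_cyclicExt hN (hΨC t htI))
      (fun i => by split_ifs <;> norm_num) (fun j hj => ⟨(hσ j hj).1, (hσ j hj).2.1⟩)
      (exists_edge_ne (hne t htI))
end
end

section
/- Let N ≥ 3 and let Γ : ℝ → ℝ be 2π-periodic, twice differentiable on (0, 2π), with Γ′(θ) > 0 for every θ ∈ (0, 2π), and with second derivative of constant sign on (0, 2π). Let I ⊆ ℝ be an interval and let Θ, Ψ : I → ℝ^{N−2} be solutions of the reduced C′₁ dynamics on I such that Θ(t) ∈ C′₁, Ψ(t) ∈ C′₁ and Θ(t) ≠ Ψ(t) for every t ∈ I. Then the function t ↦ ‖Θ(t) − Ψ(t)‖_{(1)} is strictly increasing on I. -/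
open Real Filter Set Topology

noncomputable section

lemma abs_le_sum_range_abs_sub (e : ℕ → ℝ) (h0 : e 0 = 0) (m : ℕ) :
    |e m| ≤ ∑ i ∈ Finset.range m, |e (i + 1) - e i| := by
  have h := Finset.abs_sum_le_sum_abs (fun i => e (i + 1) - e i) (Finset.range m)
  rwa [Finset.sum_range_sub, h0, sub_zero] at h

/-- Weighting a sequence starting at `0` by an antitone sequence `c` keeps at least the last weight
times its total variation, measured along the signs of the increments. -/
lemma antitone_mul_variation_le (e c σ : ℕ → ℝ) (h0 : e 0 = 0) (hσ : ∀ i, |σ i| ≤ 1)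
    (hσe : ∀ i, σ i * (e (i + 1) - e i) = |e (i + 1) - e i|) (hc : Antitone c) (m : ℕ) :
    c m * ∑ i ∈ Finset.range m, |e (i + 1) - e i| ≤
      ∑ i ∈ Finset.range m, σ i * (c (i + 1) * e (i + 1) - c i * e i) := by
  induction m with
  | zero => simp
  | succ m ih =>
    rw [Finset.sum_range_succ, Finset.sum_range_succ]
    have h1 := abs_le_sum_range_abs_sub e h0 m
    have h2 : 0 ≤ c m - c (m + 1) := sub_nonneg.2 (hc (Nat.le_succ m))
    have h3 : σ m * e m ≤ |e m| := by
      calc σ m * e m ≤ |σ m * e m| := le_abs_self _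
        _ = |σ m| * |e m| := abs_mul _ _
        _ ≤ 1 * |e m| := by gcongr; exact hσ m
        _ = |e m| := one_mul _
    have h4 := mul_le_mul_of_nonneg_left (h3.trans h1) h2
    have h5 := hσe m
    have h6 : σ m * (c (m + 1) * e (m + 1) - c m * e m) =
        c (m + 1) * |e (m + 1) - e m| - (c m - c (m + 1)) * (σ m * e m) := by
      rw [← h5]; ring
    rw [h6]
    linarith

lemma monotone_mul_variation_le (e c σ : ℕ → ℝ) (n : ℕ) (hn : e n = 0) (hσ : ∀ i, |σ i| ≤ 1)
    (hσe : ∀ i, σ i * (e (i + 1) - e i) = |e (i + 1) - e i|) (hc : Monotone c) :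
    c 0 * ∑ i ∈ Finset.range n, |e (i + 1) - e i| ≤
      ∑ i ∈ Finset.range n, σ i * (c (i + 1) * e (i + 1) - c i * e i) := by
  have h := antitone_mul_variation_le (fun i => e (n - i)) (fun i => c (n - i))
    (fun i => -σ (n - 1 - i)) (by simpa using hn) (fun i => by simpa using hσ _)
    (fun i => by
      rcases lt_or_ge i n with hi | hi
      · have h1 : n - i = n - 1 - i + 1 := by omega
        have h2 : n - (i + 1) = n - 1 - i := by omega
        simp only [h1, h2]
        rw [abs_sub_comm, ← hσe]; ring
      · have h1 : n - i = 0 := by omega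
        have h2 : n - (i + 1) = 0 := by omega
        simp [h1, h2])
    (fun i j hij => hc (by omega)) n
  simp only [Nat.sub_self] at h
  rw [← Finset.sum_range_reflect (fun i => |e (i + 1) - e i|),
    ← Finset.sum_range_reflect (fun i => σ i * (c (i + 1) * e (i + 1) - c i * e i))]
  refine le_trans (le_of_eq ?_) (h.trans (le_of_eq ?_))
  · congr 1
    refine Finset.sum_congr rfl fun i hi => ?_
    have hi := Finset.mem_range.1 hi
    have h1 : n - i = n - 1 - i + 1 := by omega
    have h2 : n - (i + 1) = n - 1 - i := by omega
    rw [h1, h2, abs_sub_comm]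
  · refine Finset.sum_congr rfl fun i hi => ?_
    have hi := Finset.mem_range.1 hi
    have h1 : n - i = n - 1 - i + 1 := by omega
    have h2 : n - (i + 1) = n - 1 - i := by omega
    rw [h1, h2]; ring

/-- The mean of `Γ'` over the segment from `b` to `a`. -/
def segMean (Γ' : ℝ → ℝ) (b a : ℝ) : ℝ := ∫ u in (0 : ℝ)..1, Γ' (b + u * (a - b))

lemma segment_mem_Ioo_s3 {T a b u : ℝ} (ha : a ∈ Ioo 0 T) (hb : b ∈ Ioo 0 T) (hu : u ∈ Icc (0 : ℝ) 1) :
    b + u * (a - b) ∈ Ioo 0 T := by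
  have h := (convex_Ioo 0 T) hb ha (sub_nonneg.2 hu.2) hu.1 (by ring)
  have h2 : (1 - u) • b + u • a = b + u * (a - b) := by simp only [smul_eq_mul]; ring
  rwa [h2] at h

lemma intervalIntegrable_segment_s3 {Γ' : ℝ → ℝ} {T a b : ℝ} (hc : ContinuousOn Γ' (Ioo 0 T))
    (ha : a ∈ Ioo 0 T) (hb : b ∈ Ioo 0 T) :
    IntervalIntegrable (fun u => Γ' (b + u * (a - b))) MeasureTheory.volume 0 1 := by
  apply ContinuousOn.intervalIntegrable
  rw [uIcc_of_le zero_le_one]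
  exact hc.comp (by fun_prop) fun u hu => segment_mem_Ioo_s3 ha hb hu

lemma segMean_mul_sub {Γ Γ' : ℝ → ℝ} {T a b : ℝ} (hd : ∀ θ ∈ Ioo 0 T, HasDerivAt Γ (Γ' θ) θ)
    (hc : ContinuousOn Γ' (Ioo 0 T)) (ha : a ∈ Ioo 0 T) (hb : b ∈ Ioo 0 T) :
    segMean Γ' b a * (a - b) = Γ a - Γ b := by
  have h := intervalIntegral.integral_eq_sub_of_hasDerivAt (a := 0) (b := 1)
    (f := fun u => Γ (b + u * (a - b))) (f' := fun u => Γ' (b + u * (a - b)) * (a - b))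
    (fun u hu => by
      rw [uIcc_of_le zero_le_one] at hu
      have h1 : HasDerivAt (fun u : ℝ => b + u * (a - b)) (a - b) u := by
        simpa using ((hasDerivAt_id u).mul_const (a - b)).const_add b
      exact (hd _ (segment_mem_Ioo_s3 ha hb hu)).comp u h1)
    ((intervalIntegrable_segment_s3 hc ha hb).mul_const _)
  rw [intervalIntegral.integral_mul_const] at h
  rw [segMean, h]
  simp

lemma segMean_pos {Γ' : ℝ → ℝ} {T a b : ℝ} (hpos : ∀ θ ∈ Ioo 0 T, 0 < Γ' θ)
    (hc : ContinuousOn Γ' (Ioo 0 T)) (ha : a ∈ Ioo 0 T) (hb : b ∈ Ioo 0 T) :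
    0 < segMean Γ' b a :=
  intervalIntegral.intervalIntegral_pos_of_pos_on (intervalIntegrable_segment_s3 hc ha hb)
    (fun _ hu => hpos _ (segment_mem_Ioo_s3 ha hb ⟨hu.1.le, hu.2.le⟩)) zero_lt_one

lemma segment_le_segment_s3 {a a' b b' u : ℝ} (haa : a ≤ a') (hbb : b ≤ b')
    (hu : u ∈ Icc (0 : ℝ) 1) : b + u * (a - b) ≤ b' + u * (a' - b') := by
  have h1 := mul_le_mul_of_nonneg_left haa hu.1
  have h2 := mul_le_mul_of_nonneg_left hbb (sub_nonneg.2 hu.2)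
  linarith

lemma segMean_mono {Γ' : ℝ → ℝ} {T a b a' b' : ℝ} (hm : MonotoneOn Γ' (Ioo 0 T))
    (hc : ContinuousOn Γ' (Ioo 0 T)) (ha : a ∈ Ioo 0 T) (hb : b ∈ Ioo 0 T)
    (ha' : a' ∈ Ioo 0 T) (hb' : b' ∈ Ioo 0 T) (haa : a ≤ a') (hbb : b ≤ b') :
    segMean Γ' b a ≤ segMean Γ' b' a' :=
  intervalIntegral.integral_mono_on zero_le_one (intervalIntegrable_segment_s3 hc ha hb)
    (intervalIntegrable_segment_s3 hc ha' hb') fun _ hu =>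
      hm (segment_mem_Ioo_s3 ha hb hu) (segment_mem_Ioo_s3 ha' hb' hu) (segment_le_segment_s3 haa hbb hu)

lemma segMean_anti {Γ' : ℝ → ℝ} {T a b a' b' : ℝ} (hm : AntitoneOn Γ' (Ioo 0 T))
    (hc : ContinuousOn Γ' (Ioo 0 T)) (ha : a ∈ Ioo 0 T) (hb : b ∈ Ioo 0 T)
    (ha' : a' ∈ Ioo 0 T) (hb' : b' ∈ Ioo 0 T) (haa : a ≤ a') (hbb : b ≤ b') :
    segMean Γ' b' a' ≤ segMean Γ' b a :=
  intervalIntegral.integral_mono_on zero_le_one (intervalIntegrable_segment_s3 hc ha' hb')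
    (intervalIntegrable_segment_s3 hc ha hb) fun _ hu =>
      hm (segment_mem_Ioo_s3 ha hb hu) (segment_mem_Ioo_s3 ha' hb' hu) (segment_le_segment_s3 haa hbb hu)

/-- Along two partitions `a`, `b` of `[0, T]`, the signed variation of `Γ ∘ a - Γ ∘ b` dominates
a positive multiple of the total variation of `a - b`. -/
lemma exists_pos_mul_variation_le {Γ Γ' : ℝ → ℝ} {T : ℝ}
    (hd : ∀ θ ∈ Ioo 0 T, HasDerivAt Γ (Γ' θ) θ) (hc : ContinuousOn Γ' (Ioo 0 T))
    (hpos : ∀ θ ∈ Ioo 0 T, 0 < Γ' θ)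
    (hm : MonotoneOn Γ' (Ioo 0 T) ∨ AntitoneOn Γ' (Ioo 0 T))
    {n : ℕ} (hn : 2 ≤ n) {a b σ : ℕ → ℝ} (ha : StrictMono a) (hb : StrictMono b)
    (ha0 : a 0 = 0) (hb0 : b 0 = 0) (han : a n = T) (hbn : b n = T) (hσ : ∀ i, |σ i| ≤ 1)
    (hσe : ∀ i, σ i * ((a (i + 1) - b (i + 1)) - (a i - b i)) =
      |(a (i + 1) - b (i + 1)) - (a i - b i)|) :
    ∃ c > 0, c * ∑ i ∈ Finset.range n, |(a (i + 1) - b (i + 1)) - (a i - b i)| ≤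
      ∑ i ∈ Finset.range n,
        σ i * ((Γ (a (i + 1)) - Γ (b (i + 1))) - (Γ (a i) - Γ (b i))) := by
  let κ : ℕ → ℕ := fun i => max 1 (min i (n - 1))
  have hκm : Monotone κ := fun i j hij => by simp only [κ]; omega
  have hκa : ∀ i, a (κ i) ∈ Ioo 0 T := fun i =>
    ⟨ha0 ▸ ha (by simp only [κ]; omega), han ▸ ha (by simp only [κ]; omega)⟩
  have hκb : ∀ i, b (κ i) ∈ Ioo 0 T := fun i =>
    ⟨hb0 ▸ hb (by simp only [κ]; omega), hbn ▸ hb (by simp only [κ]; omega)⟩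
  let c : ℕ → ℝ := fun i => segMean Γ' (b (κ i)) (a (κ i))
  have hcpos : ∀ i, 0 < c i := fun i => segMean_pos hpos hc (hκa i) (hκb i)
  have hg : ∀ i ≤ n, Γ (a i) - Γ (b i) = c i * (a i - b i) := by
    intro i hi
    rcases Nat.eq_zero_or_pos i with rfl | h0
    · simp [ha0, hb0]
    rcases hi.eq_or_lt with rfl | h1
    · simp [han, hbn]
    have hκ : κ i = i := by simp only [κ]; omega
    have h := segMean_mul_sub hd hc (hκa i) (hκb i)
    simp only [c]
    rw [hκ] at h ⊢
    exact h.symm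
  have hsum : ∑ i ∈ Finset.range n,
        σ i * ((Γ (a (i + 1)) - Γ (b (i + 1))) - (Γ (a i) - Γ (b i))) =
      ∑ i ∈ Finset.range n, σ i * (c (i + 1) * (a (i + 1) - b (i + 1)) - c i * (a i - b i)) := by
    refine Finset.sum_congr rfl fun i hi => ?_
    have hi := Finset.mem_range.1 hi
    rw [hg i hi.le, hg (i + 1) hi]
  rw [hsum]
  rcases hm with hm | hm
  · exact ⟨c 0, hcpos 0, monotone_mul_variation_le (fun i => a i - b i) c σ n
      (by simp [han, hbn]) hσ hσe fun i j hij => segMean_mono hm hc (hκa i) (hκb i) (hκa j) (hκb j)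
        (ha.monotone (hκm hij)) (hb.monotone (hκm hij))⟩
  · exact ⟨c n, hcpos n, antitone_mul_variation_le (fun i => a i - b i) c σ
      (by simp [ha0, hb0]) hσ hσe (fun i j hij => segMean_anti hm hc (hκa i) (hκb i) (hκa j) (hκb j)
        (ha.monotone (hκm hij)) (hb.monotone (hκm hij))) n⟩

lemma sum_range_shift_of_periodic {h : ℕ → ℝ} {n : ℕ} (hp : ∀ i, h (i + n) = h i) (j : ℕ) :
    ∑ i ∈ Finset.range n, h (j + i) = ∑ i ∈ Finset.range n, h i := by
  induction j with
  | zero => simp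
  | succ j ih =>
    rw [← ih]
    have h1 := Finset.sum_range_succ (fun i => h (j + i)) n
    have h2 := Finset.sum_range_succ' (fun i => h (j + i)) n
    simp only [add_zero, hp] at h1 h2
    have h3 : ∀ i, j + 1 + i = j + (i + 1) := fun i => by ring
    simp only [h3]
    linarith

/-- Cyclic version with `n` weighted phases on a circle of length `T`, lifted to `ℕ`. -/
lemma cyclic_signed_variation_pos {Γ Γ' : ℝ → ℝ} {T : ℝ} (hper : ∀ θ, Γ (θ + T) = Γ θ)
    (hd : ∀ θ ∈ Ioo 0 T, HasDerivAt Γ (Γ' θ) θ) (hc : ContinuousOn Γ' (Ioo 0 T))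
    (hpos : ∀ θ ∈ Ioo 0 T, 0 < Γ' θ)
    (hm : MonotoneOn Γ' (Ioo 0 T) ∨ AntitoneOn Γ' (Ioo 0 T))
    {n : ℕ} (hn : 2 ≤ n) {X Y s w : ℕ → ℝ} (hX : StrictMono X) (hY : StrictMono Y)
    (hXp : ∀ i, X (i + n) = X i + T) (hYp : ∀ i, Y (i + n) = Y i + T)
    (hs : ∀ i, |s i| ≤ 1) (hsp : ∀ i, s (i + n) = s i)
    (hse : ∀ i, s i * ((X (i + 1) - Y (i + 1)) - (X i - Y i)) =
      |(X (i + 1) - Y (i + 1)) - (X i - Y i)|)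
    (hw : ∀ j, 0 < w j)
    (hTV : 0 < ∑ i ∈ Finset.range n, |(X (i + 1) - Y (i + 1)) - (X i - Y i)|) :
    0 < ∑ k ∈ Finset.range n, s k *
      ((∑ j ∈ Finset.range n, w j * (Γ (X (k + 1) - X j) - Γ (Y (k + 1) - Y j))) -
        ∑ j ∈ Finset.range n, w j * (Γ (X k - X j) - Γ (Y k - Y j))) := by
  have key : ∀ j, 0 < ∑ k ∈ Finset.range n, s k *
      ((Γ (X (k + 1) - X j) - Γ (Y (k + 1) - Y j)) - (Γ (X k - X j) - Γ (Y k - Y j))) := by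
    intro j
    obtain ⟨c, hc0, hle⟩ := exists_pos_mul_variation_le hd hc hpos hm hn
      (a := fun i => X (j + i) - X j) (b := fun i => Y (j + i) - Y j) (σ := fun i => s (j + i))
      (fun i k hik => sub_lt_sub_right (hX (by omega)) _)
      (fun i k hik => sub_lt_sub_right (hY (by omega)) _)
      (by simp) (by simp) (by simp [hXp]) (by simp [hYp]) (fun i => hs _)
      (fun i => by
        have h := hse (j + i)
        rw [add_assoc] at h
        have e : (X (j + (i + 1)) - X j - (Y (j + (i + 1)) - Y j)) -
          (X (j + i) - X j - (Y (j + i) - Y j)) =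
            (X (j + (i + 1)) - Y (j + (i + 1))) - (X (j + i) - Y (j + i)) := by ring
        rw [e]; exact h)
    have h1 := sum_range_shift_of_periodic (n := n)
      (h := fun i => |(X (i + 1) - Y (i + 1)) - (X i - Y i)|)
      (fun i => by
        rw [show i + n + 1 = i + 1 + n by ring, hXp, hXp, hYp, hYp]; congr 1; ring) j
    have h2 := sum_range_shift_of_periodic (n := n)
      (h := fun k => s k *
        ((Γ (X (k + 1) - X j) - Γ (Y (k + 1) - Y j)) - (Γ (X k - X j) - Γ (Y k - Y j))))
      (fun i => by
        simp only [show i + n + 1 = i + 1 + n by ring, hXp, hYp, hsp, add_sub_right_comm, hper]) j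
    rw [← h2]
    rw [← h1] at hTV
    refine (mul_pos hc0 hTV).trans_le (le_trans (le_of_eq ?_) (hle.trans (le_of_eq ?_)))
    · congr 1
      refine Finset.sum_congr rfl fun i _ => ?_
      congr 1
      rw [add_assoc]; ring
    · refine Finset.sum_congr rfl fun i _ => ?_
      rw [add_assoc]
  have hswap : ∑ k ∈ Finset.range n, s k *
      ((∑ j ∈ Finset.range n, w j * (Γ (X (k + 1) - X j) - Γ (Y (k + 1) - Y j))) -
        ∑ j ∈ Finset.range n, w j * (Γ (X k - X j) - Γ (Y k - Y j))) =
      ∑ j ∈ Finset.range n, w j * ∑ k ∈ Finset.range n, s k *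
        ((Γ (X (k + 1) - X j) - Γ (Y (k + 1) - Y j)) - (Γ (X k - X j) - Γ (Y k - Y j))) := by
    simp only [← Finset.sum_sub_distrib, Finset.mul_sum]
    rw [Finset.sum_comm]
    refine Finset.sum_congr rfl fun j _ => Finset.sum_congr rfl fun k _ => ?_
    ring
  rw [hswap]
  exact Finset.sum_pos (fun j _ => mul_pos (hw j) (key j)) ⟨0, Finset.mem_range.2 (by omega)⟩

lemma lt_of_eventually_lt_right {f : ℝ → ℝ} {a b : ℝ} (hab : a < b)
    (hf : ContinuousOn f (Icc a b))
    (h : ∀ t ∈ Ico a b, ∀ᶠ s in 𝓝[>] t, f t < f s) : f a < f b := by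
  have hle : ∀ c ∈ Icc a b, f c ≤ f b := by
    intro c hc
    have hcl : IsClosed ({x | f c ≤ f x} ∩ Icc c b) := by
      have h1 : ContinuousOn f (Icc c b) := hf.mono (Icc_subset_Icc_left hc.1)
      have := h1.preimage_isClosed_of_isClosed isClosed_Icc (isClosed_Ici (a := f c))
      rwa [inter_comm] at this
    have hsub := hcl.Icc_subset_of_forall_mem_nhdsWithin (le_refl (f c)) (fun x hx => by
      filter_upwards [h x ⟨hc.1.trans hx.2.1, hx.2.2⟩] with y hy
      exact le_trans hx.1 hy.le)
    exact hsub ⟨hc.2, le_rfl⟩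
  obtain ⟨c, hc1, hc2⟩ := ((h a ⟨le_rfl, hab⟩).and (Ioo_mem_nhdsGT hab)).exists
  exact hc1.trans_le (hle c ⟨hc2.1.le, hc2.2.le⟩)

lemma eventually_lt_right_of_hasDerivAt_pos {f : ℝ → ℝ} {f' t : ℝ} (hf : HasDerivAt f f' t)
    (hpos : 0 < f') : ∀ᶠ s in 𝓝[>] t, f t < f s := by
  have h := (hasDerivWithinAt_iff_tendsto_slope' (s := Ioi t) (by simp)).1 hf.hasDerivWithinAt
  filter_upwards [h.eventually (lt_mem_nhds hpos), self_mem_nhdsWithin] with s hs hts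
  rw [slope_def_field] at hs
  have h1 : 0 < s - t := sub_pos.2 hts
  have h2 := (div_pos_iff_of_pos_right h1).1 hs
  linarith

/-- The lift to `ℕ` of the cyclic configuration `0, x 2, …, x (p + 2)`. -/
def cyclicLift (p : ℕ) (x : ℕ → ℝ) (i : ℕ) : ℝ :=
  (if i % (p + 2) = 0 then 0 else x (i % (p + 2) + 1)) + 2 * π * (i / (p + 2) : ℕ)

lemma cyclicLift_add_period (p : ℕ) (x : ℕ → ℝ) (i : ℕ) :
    cyclicLift p x (i + (p + 2)) = cyclicLift p x i + 2 * π := by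
  simp only [cyclicLift, Nat.add_mod_right, Nat.add_div_right i (Nat.succ_pos (p + 1)),
    Nat.succ_eq_add_one]
  push_cast
  ring

lemma cyclicLift_zero (p : ℕ) (x : ℕ → ℝ) : cyclicLift p x 0 = 0 := by
  simp [cyclicLift]

lemma cyclicLift_period (p : ℕ) (x : ℕ → ℝ) : cyclicLift p x (p + 2) = 2 * π := by
  simpa [cyclicLift_zero] using cyclicLift_add_period p x 0

lemma cyclicLift_succ (p : ℕ) (x : ℕ → ℝ) {i : ℕ} (hi : i < p + 1) :
    cyclicLift p x (i + 1) = x (i + 2) := by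
  have h : i + 1 < p + 2 := by omega
  simp [cyclicLift, Nat.mod_eq_of_lt h, Nat.div_eq_of_lt h]

lemma cyclicLift_strictMono {p : ℕ} {x : ℕ → ℝ} (hx : inConeRed1 (p + 3) x) :
    StrictMono (cyclicLift p x) := by
  obtain ⟨h0, h1, h2⟩ := hx
  refine strictMono_nat_of_lt_succ fun i => ?_
  induction i using Nat.strong_induction_on with
  | _ i ih =>
    rcases lt_or_ge i (p + 2) with hi | hi
    · rcases Nat.eq_zero_or_pos i with rfl | hi0
      · rw [cyclicLift_succ p x (by omega), cyclicLift_zero]; exact h0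
      obtain ⟨k, rfl⟩ : ∃ k, i = k + 1 := ⟨i - 1, by omega⟩
      rw [cyclicLift_succ p x (by omega)]
      rcases Nat.lt_or_ge k p with hk | hk
      · rw [cyclicLift_succ p x (by omega)]
        exact h1 (k + 2) (Finset.mem_Icc.2 ⟨by omega, by omega⟩)
      · obtain rfl : k = p := by omega
        rw [cyclicLift_period]
        exact h2
    · obtain ⟨k, rfl⟩ : ∃ k, i = k + (p + 2) := ⟨i - (p + 2), by omega⟩
      rw [show k + (p + 2) + 1 = k + 1 + (p + 2) by ring, cyclicLift_add_period,
        cyclicLift_add_period]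
      linarith [ih k (by omega)]

lemma sum_Icc_two (p : ℕ) (F : ℕ → ℝ) :
    ∑ j ∈ Finset.Icc 2 (p + 2), F j = ∑ i ∈ Finset.range (p + 1), F (i + 2) := by
  rw [← Finset.Ico_add_one_right_eq_Icc, Finset.sum_Ico_eq_sum_range]
  exact Finset.sum_congr (by congr 1) fun i _ => by rw [add_comm]

lemma dist1_eq_sum_cyclicLift (p : ℕ) (x y : ℕ → ℝ) :
    dist1 2 (p + 2) x y = ∑ i ∈ Finset.range (p + 2),
      |(cyclicLift p x (i + 1) - cyclicLift p y (i + 1)) -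
        (cyclicLift p x i - cyclicLift p y i)| := by
  rw [Finset.sum_range_succ, Finset.sum_range_succ', dist1, cyclicLift_period, cyclicLift_period,
    cyclicLift_zero, cyclicLift_zero, cyclicLift_succ p x p.lt_succ_self,
    cyclicLift_succ p y p.lt_succ_self, cyclicLift_succ p x (Nat.succ_pos p),
    cyclicLift_succ p y (Nat.succ_pos p)]
  have h : ∑ j ∈ Finset.Icc 2 (p + 2 - 1), |x (j + 1) - y (j + 1) - (x j - y j)| =
      ∑ i ∈ Finset.range p, |(cyclicLift p x (i + 1 + 1) - cyclicLift p y (i + 1 + 1)) -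
        (cyclicLift p x (i + 1) - cyclicLift p y (i + 1))| := by
    rw [← Finset.Ico_add_one_right_eq_Icc, Finset.sum_Ico_eq_sum_range]
    refine Finset.sum_congr (by congr 1) fun i hi => ?_
    have hi := Finset.mem_range.1 hi
    rw [cyclicLift_succ p x (by omega), cyclicLift_succ p x (by omega),
      cyclicLift_succ p y (by omega), cyclicLift_succ p y (by omega), add_comm 2 i]
  rw [h]
  simp only [sub_self, sub_zero, zero_sub, zero_add, abs_neg]
  ring

lemma redRHS1_sub_redRHS1 (p : ℕ) (Γ : ℝ → ℝ) (x y : ℕ → ℝ) {i : ℕ} (hi : i < p + 1) :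
    redRHS1 (p + 3) Γ x (i + 2) - redRHS1 (p + 3) Γ y (i + 2) =
      (∑ j ∈ Finset.range (p + 2), (if j = 0 then 2 else 1) *
        (Γ (cyclicLift p x (i + 1) - cyclicLift p x j) -
          Γ (cyclicLift p y (i + 1) - cyclicLift p y j))) -
      ∑ j ∈ Finset.range (p + 2), (if j = 0 then 2 else 1) *
        (Γ (cyclicLift p x 0 - cyclicLift p x j) -
          Γ (cyclicLift p y 0 - cyclicLift p y j)) := by
  have hmem : i + 2 ∈ Finset.Icc 2 (p + 2) := Finset.mem_Icc.2 ⟨by omega, by omega⟩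
  have hs : ∀ z : ℕ → ℝ, ∑ j ∈ (Finset.Icc 2 (p + 2)).erase (i + 2), Γ (z (i + 2) - z j) =
      ∑ j ∈ Finset.range (p + 1), Γ (z (i + 2) - z (j + 2)) - Γ 0 := by
    intro z
    have h := Finset.sum_erase_add (Finset.Icc 2 (p + 2)) (fun j => Γ (z (i + 2) - z j)) hmem
    rw [sum_Icc_two, sub_self] at h
    linarith
  have hr : ∀ F : ℕ → ℝ, ∑ j ∈ Finset.range (p + 2), (if j = 0 then 2 else 1) * F j =
      ∑ j ∈ Finset.range (p + 1), F (j + 1) + 2 * F 0 := by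
    intro F
    rw [Finset.sum_range_succ']
    simp
  have hl : ∀ F : ℝ → ℝ → ℝ, ∑ j ∈ Finset.range (p + 1),
      F (cyclicLift p x (j + 1)) (cyclicLift p y (j + 1)) =
        ∑ j ∈ Finset.range (p + 1), F (x (j + 2)) (y (j + 2)) := fun F =>
    Finset.sum_congr rfl fun j hj => by
      rw [cyclicLift_succ p x (Finset.mem_range.1 hj), cyclicLift_succ p y (Finset.mem_range.1 hj)]
  rw [hr, hr, hl fun u v => Γ (cyclicLift p x (i + 1) - u) - Γ (cyclicLift p y (i + 1) - v),
    hl fun u v => Γ (cyclicLift p x 0 - u) - Γ (cyclicLift p y 0 - v)]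
  simp only [redRHS1, show p + 3 - 1 = p + 2 from rfl, hs, sum_Icc_two, cyclicLift_zero,
    cyclicLift_succ p x hi, cyclicLift_succ p y hi, zero_sub, sub_zero, Finset.sum_sub_distrib]
  ring

/-- Expansion of the reduced `C′₁` dynamics for an increasing coupling function. -/
theorem expansion_reducedC1_of_increasing_coupling
    (N : ℕ) (hN : 3 ≤ N) (Γ Γ' Γ'' : ℝ → ℝ)
    (hper : ∀ θ : ℝ, Γ (θ + 2 * π) = Γ θ)
    (hd1 : ∀ θ ∈ Ioo (0 : ℝ) (2 * π), HasDerivAt Γ (Γ' θ) θ)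
    (hd2 : ∀ θ ∈ Ioo (0 : ℝ) (2 * π), HasDerivAt Γ' (Γ'' θ) θ)
    (hmono : ∀ θ ∈ Ioo (0 : ℝ) (2 * π), 0 < Γ' θ)
    (hcurv : (∀ θ ∈ Ioo (0 : ℝ) (2 * π), 0 ≤ Γ'' θ) ∨
      (∀ θ ∈ Ioo (0 : ℝ) (2 * π), Γ'' θ ≤ 0))
    (I : Set ℝ) (hI : I.OrdConnected)
    (Θ Ψ : ℝ → ℕ → ℝ)
    (hΘ : IsSolRed1 N Γ I Θ) (hΨ : IsSolRed1 N Γ I Ψ)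
    (hΘC : ∀ t ∈ I, inConeRed1 N (Θ t)) (hΨC : ∀ t ∈ I, inConeRed1 N (Ψ t))
    (hne : ∀ t ∈ I, ∃ k ∈ Finset.Icc 2 (N - 1), Θ t k ≠ Ψ t k) :
    ∀ t₁ ∈ I, ∀ t₂ ∈ I, t₁ < t₂ →
      dist1 2 (N - 1) (Θ t₁) (Ψ t₁) < dist1 2 (N - 1) (Θ t₂) (Ψ t₂) := by
  obtain ⟨p, rfl⟩ : ∃ p, N = p + 3 := ⟨N - 3, by omega⟩
  have hc : ContinuousOn Γ' (Ioo 0 (2 * π)) := fun θ hθ =>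
    (hd2 θ hθ).continuousAt.continuousWithinAt
  have hm : MonotoneOn Γ' (Ioo 0 (2 * π)) ∨ AntitoneOn Γ' (Ioo 0 (2 * π)) := by
    refine hcurv.imp (fun h => ?_) fun h => ?_
    · refine monotoneOn_of_hasDerivWithinAt_nonneg (f' := Γ'') (convex_Ioo _ _) hc ?_ ?_
      · intro θ hθ
        rw [interior_Ioo] at hθ
        exact (hd2 θ hθ).hasDerivWithinAt
      · intro θ hθ
        rw [interior_Ioo] at hθ
        exact h θ hθ
    · refine antitoneOn_of_hasDerivWithinAt_nonpos (f' := Γ'') (convex_Ioo _ _) hc ?_ ?_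
      · intro θ hθ
        rw [interior_Ioo] at hθ
        exact (hd2 θ hθ).hasDerivWithinAt
      · intro θ hθ
        rw [interior_Ioo] at hθ
        exact h θ hθ
  let E : ℕ → ℝ → ℝ := fun k t => cyclicLift p (Θ t) k - cyclicLift p (Ψ t) k
  let W : ℝ → ℕ → ℝ := fun t k => ∑ j ∈ Finset.range (p + 2), (if j = 0 then 2 else 1) *
    (Γ (cyclicLift p (Θ t) k - cyclicLift p (Θ t) j) -
      Γ (cyclicLift p (Ψ t) k - cyclicLift p (Ψ t) j))
  have hE : ∀ t ∈ I, ∀ k ≤ p + 2, HasDerivAt (E k) (W t k - W t 0) t := by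
    intro t ht k hk
    rcases Nat.eq_zero_or_pos k with rfl | hk0
    · simpa [E, cyclicLift_zero] using hasDerivAt_const t (0 : ℝ)
    rcases hk.eq_or_lt with rfl | hk1
    · have hW : W t (p + 2) = W t 0 := by
        have hΓ : ∀ u, Γ (2 * π - u) = Γ (0 - u) := fun u => by
          rw [← hper (0 - u)]; congr 1; ring
        simp only [W, cyclicLift_period, cyclicLift_zero, hΓ]
      rw [hW, sub_self]
      simpa [E, cyclicLift_period] using hasDerivAt_const t (0 : ℝ)
    obtain ⟨i, rfl⟩ : ∃ i, k = i + 1 := ⟨k - 1, by omega⟩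
    have hi : i < p + 1 := by omega
    have hmem : i + 2 ∈ Finset.Icc 2 (p + 3 - 1) := Finset.mem_Icc.2 ⟨by omega, by omega⟩
    have h := (hΘ _ hmem t ht).sub (hΨ _ hmem t ht)
    rw [redRHS1_sub_redRHS1 p Γ _ _ hi] at h
    have hEi : E (i + 1) = fun s => Θ s (i + 2) - Ψ s (i + 2) := by
      funext s
      simp only [E, cyclicLift_succ p _ hi]
    rw [hEi]
    exact h
  have hdist : ∀ t, dist1 2 (p + 3 - 1) (Θ t) (Ψ t) =
      ∑ i ∈ Finset.range (p + 2), |E (i + 1) t - E i t| := fun t =>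
    dist1_eq_sum_cyclicLift p (Θ t) (Ψ t)
  have hcont : ∀ t ∈ I, ContinuousAt
      (fun t => ∑ i ∈ Finset.range (p + 2), |E (i + 1) t - E i t|) t := by
    intro t ht
    refine tendsto_finsetSum _ fun i hi => ?_
    have hi := Finset.mem_range.1 hi
    exact ((hE t ht (i + 1) hi).continuousAt.sub (hE t ht i hi.le).continuousAt).abs
  intro t₁ ht₁ t₂ ht₂ hlt
  have hsub : Icc t₁ t₂ ⊆ I := hI.out ht₁ ht₂
  rw [hdist, hdist]
  refine lt_of_eventually_lt_right hlt
    (fun t ht => (hcont t (hsub ht)).continuousWithinAt) fun t ht => ?_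
  have htI : t ∈ I := hsub ⟨ht.1, ht.2.le⟩
  let s : ℕ → ℝ := fun i => (SignType.sign (E (i + 1) t - E i t) : ℝ)
  have hs : ∀ i, |s i| ≤ 1 := by
    intro i
    simp only [s]
    rcases lt_trichotomy (E (i + 1) t - E i t) 0 with h | h | h <;> simp [h]
  have hse : ∀ i, s i * (E (i + 1) t - E i t) = |E (i + 1) t - E i t| := fun i =>
    sign_mul_self _
  have hEp : ∀ i, E (i + (p + 2)) t = E i t := fun i => by
    simp only [E, cyclicLift_add_period]; ring
  have hTV : 0 < ∑ i ∈ Finset.range (p + 2), |E (i + 1) t - E i t| := by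
    obtain ⟨k, hk, hne⟩ := hne t htI
    obtain ⟨hk2, hk3⟩ := Finset.mem_Icc.1 hk
    obtain ⟨i, rfl⟩ : ∃ i, k = i + 2 := ⟨k - 2, by omega⟩
    have hi : i < p + 1 := by omega
    have h0 : 0 < |E (i + 1) t| := by
      simp only [E, cyclicLift_succ p _ hi]
      exact abs_pos.2 (sub_ne_zero.2 hne)
    refine h0.trans_le ((abs_le_sum_range_abs_sub (fun i => E i t)
      (by simp [E, cyclicLift_zero]) (i + 1)).trans ?_)
    exact Finset.sum_le_sum_of_subset_of_nonneg (Finset.range_subset_range.2 (by omega))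
      fun _ _ _ => abs_nonneg _
  have hQ : 0 < ∑ k ∈ Finset.range (p + 2), s k * (W t (k + 1) - W t k) :=
    cyclic_signed_variation_pos hper hd1 hc hmono hm (by omega)
      (cyclicLift_strictMono (hΘC t htI)) (cyclicLift_strictMono (hΨC t htI))
      (cyclicLift_add_period p _) (cyclicLift_add_period p _) hs
      (fun i => by
        simp only [s]
        rw [show i + (p + 2) + 1 = i + 1 + (p + 2) by ring, hEp, hEp])
      hse (fun j => by split_ifs <;> norm_num) hTV
  have hL : HasDerivAt (fun τ => ∑ k ∈ Finset.range (p + 2), s k * (E (k + 1) τ - E k τ))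
      (∑ k ∈ Finset.range (p + 2), s k * (W t (k + 1) - W t k)) t := by
    refine HasDerivAt.fun_sum fun k hk => ?_
    have hk := Finset.mem_range.1 hk
    have h := ((hE t htI (k + 1) hk).sub (hE t htI k hk.le)).const_mul (s k)
    rw [sub_sub_sub_cancel_right] at h
    exact h
  filter_upwards [eventually_lt_right_of_hasDerivAt_pos hL hQ] with τ hτ
  simp only [hse] at hτ
  refine hτ.trans_le (Finset.sum_le_sum fun k _ => ?_)
  calc s k * (E (k + 1) τ - E k τ) ≤ |s k * (E (k + 1) τ - E k τ)| := le_abs_self _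
    _ = |s k| * |E (k + 1) τ - E k τ| := abs_mul _ _
    _ ≤ 1 * |E (k + 1) τ - E k τ| := by gcongr; exact hs k
    _ = |E (k + 1) τ - E k τ| := one_mul _
end
end
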